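/- Let n > 4 be a natural number and let k be a positive integer. Then k ≥ n - 1 if and only if for every irreducible complex character χ of the symmetric group S_n with χ(1) > 1 and every irreducible complex character θ of S_n, the inner product ⟨χ^k, θ⟩ is nonzero (i.e., every irreducible character is a constituent of the k-th pointwise power χ^k). -/

import Mathlib

open scoped ComplexOrder

noncomputable section

/-- `χ : G → ℂ` is the character of some finite-dimensional complex representation of `G`. -/
def IsChar (G : Type) [Group G] [Fintype G] (χ : G → ℂ) : Prop :=
  ∃ V : FDRep ℂ G, χ = V.character

/-- `χ : G → ℂ` is the character of some irreducible (simple) finite-dimensional complex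
representation of `G`. -/
def IsIrredChar (G : Type) [Group G] [Fintype G] (χ : G → ℂ) : Prop :=
  ∃ V : FDRep ℂ G, CategoryTheory.Simple V ∧ χ = V.character

/-- The usual inner product of class functions:
`⟨φ, ψ⟩ = |G|⁻¹ ∑ g, φ g * conj (ψ g)`. -/
def charInner (G : Type) [Group G] [Fintype G] (φ ψ : G → ℂ) : ℂ :=
  (Fintype.card G : ℂ)⁻¹ * ∑ g : G, φ g * (starRingEnd ℂ) (ψ g)
namespace SnCov
open Equiv Finset
universe u

section

lemma mem_of_ann {ι : Type*} [Fintype ι] (J : Submodule ℂ (ι → ℂ)) (f : ι → ℂ)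
    (h : ∀ a : ι → ℂ, (∀ u ∈ J, ∑ i, a i * u i = 0) → ∑ i, a i * f i = 0) : f ∈ J := by
  classical
  by_contra hf
  obtain ⟨φ, hφ, hJ⟩ := Submodule.exists_le_ker_of_notMem hf
  have key : ∀ u : ι → ℂ, φ u = ∑ i, φ (Pi.single i 1) * u i := by
    intro u
    conv_lhs => rw [pi_eq_sum_univ' u]
    simp only [map_sum, map_smul, smul_eq_mul]
    refine Finset.sum_congr rfl fun i _ => ?_
    rw [mul_comm]
  apply hφ
  rw [key]
  apply h
  intro u hu
  rw [← key]
  exact hJ hu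

/-- matrix coefficients -/
def coef {G R : Type*} [Ring R] [Algebra ℂ R] (π : G → R) : Submodule ℂ (G → ℂ) where
  carrier := {f | ∃ l : R →ₗ[ℂ] ℂ, ∀ g, f g = l (π g)}
  add_mem' := by
    rintro f f' ⟨l, hl⟩ ⟨l', hl'⟩
    exact ⟨l + l', fun g => by simp [hl, hl']⟩
  zero_mem' := ⟨0, fun g => by simp⟩
  smul_mem' := by
    rintro c f ⟨l, hl⟩
    exact ⟨c • l, fun g => by simp [hl]⟩

section
variable {G H R R' : Type*} [Ring R] [Algebra ℂ R] [Ring R'] [Algebra ℂ R']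

lemma coef_mem (π : G → R) (l : R →ₗ[ℂ] ℂ) : (fun g => l (π g)) ∈ coef π := ⟨l, fun _ => rfl⟩

lemma eq_zero_of_dual {x : R} (h : ∀ l : R →ₗ[ℂ] ℂ, l x = 0) : x = 0 :=
  (Module.forall_dual_apply_eq_zero_iff ℂ x).1 h

lemma ann_coef [Fintype G] (π : G → R) (a : G → ℂ) (h : ∀ u ∈ coef π, ∑ g, a g * u g = 0) :
    ∑ g, a g • π g = 0 := by
  apply eq_zero_of_dual
  intro l
  simpa using h _ (coef_mem π l)

/-- pullback of functions -/
def pull (i : H → G) : (G → ℂ) →ₐ[ℂ] (H → ℂ) where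
  toFun f := f ∘ i
  map_one' := rfl
  map_mul' _ _ := rfl
  map_zero' := rfl
  map_add' _ _ := rfl
  commutes' _ := rfl

@[simp] lemma pull_apply (i : H → G) (f : G → ℂ) (h : H) : pull i f h = f (i h) := rfl

lemma map_pull_coef (i : H → G) (π : G → R) :
    (coef π).map (pull i).toLinearMap = coef (fun h => π (i h)) := by
  ext f
  constructor
  · rintro ⟨u, ⟨l, hl⟩, rfl⟩
    exact ⟨l, fun h => hl (i h)⟩
  · rintro ⟨l, hl⟩
    exact ⟨_, coef_mem π l, by ext h; exact (hl h).symm⟩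

/-- left invariance -/
def LInv [Mul G] (J : Submodule ℂ (G → ℂ)) : Prop := ∀ h : G, J.map (pull (fun g => h * g)).toLinearMap ≤ J

lemma LInv.mul [Mul G] {J K : Submodule ℂ (G → ℂ)} (hJ : LInv J) (hK : LInv K) : LInv (J * K) := by
  intro h
  rw [Submodule.map_mul]
  exact mul_le_mul' (hJ h) (hK h)

lemma LInv.one [Mul G] : LInv (1 : Submodule ℂ (G → ℂ)) := by
  intro h
  rw [Submodule.map_one]

lemma LInv.pow [Mul G] {J : Submodule ℂ (G → ℂ)} (hJ : LInv J) (k : ℕ) : LInv (J ^ k) := by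
  induction k with
  | zero => exact LInv.one
  | succ k ih => rw [pow_succ]; exact ih.mul hJ

lemma LInv.coef [Mul G] {π : G → R} (hπ : ∀ g h, π (g * h) = π g * π h) : LInv (coef π) := by
  rintro h f ⟨u, ⟨l, hl⟩, rfl⟩
  exact ⟨l ∘ₗ LinearMap.mulLeft ℂ (π h), fun g => by simp [hl, hπ]⟩

lemma top_of_delta [Group G] [Fintype G] [DecidableEq G] {J : Submodule ℂ (G → ℂ)} (hJ : LInv J)
    (h1 : (fun g : G => if g = 1 then (1:ℂ) else 0) ∈ J) : J = ⊤ := by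
  rw [eq_top_iff]
  intro f _
  have : f = ∑ h, f h • (fun g : G => if g = h then (1:ℂ) else 0) := by
    ext g
    simp
  rw [this]
  refine Submodule.sum_mem _ fun h _ => Submodule.smul_mem _ _ ?_
  refine hJ h⁻¹ ⟨_, h1, ?_⟩
  ext g
  simp [inv_mul_eq_one, eq_comm]

/-- support step -/
lemma top_of_support [Group G] [Fintype G] [DecidableEq G] [Group H] [DecidableEq H]
    (i : H →* G) (hi : Function.Injective i)
    {J K : Submodule ℂ (G → ℂ)} (hJ : LInv J) (hK : LInv K) (u : G → ℂ) (hu : u ∈ J)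
    (hu1 : u 1 = 1) (hu0 : ∀ g, g ∉ Set.range i → u g = 0)
    (hKt : K.map (pull i).toLinearMap = ⊤) : J * K = ⊤ := by
  apply top_of_delta (hJ.mul hK)
  have : (fun g : H => if g = 1 then (1:ℂ) else 0) ∈ K.map (pull i).toLinearMap := by
    rw [hKt]; trivial
  obtain ⟨v, hv, hv'⟩ := this
  have : (fun g : G => if g = 1 then (1:ℂ) else 0) = u * v := by
    ext g
    by_cases hg : g ∈ Set.range i
    · obtain ⟨h, rfl⟩ := hg
      have := congrFun hv' h
      simp only [AlgHom.toLinearMap_apply, pull_apply] at this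
      simp only [Pi.mul_apply, this]
      by_cases hh : h = 1
      · subst hh; simp [hu1]
      · have : i h ≠ 1 := fun h' => hh (hi (by simpa using h'))
        simp [hh, this]
    · have : g ≠ 1 := by rintro rfl; exact hg ⟨1, map_one i⟩
      simp [this, hu0 g hg]
  rw [this]
  exact Submodule.mul_mem_mul hu hv

lemma bilin_mem [FiniteDimensional ℂ R] (π : G → R) (π' : G → R') (β : R →ₗ[ℂ] R' →ₗ[ℂ] ℂ) :
    (fun g => β (π g) (π' g)) ∈ coef π * coef π' := by
  let b := Module.finBasis ℂ R
  have : (fun g => β (π g) (π' g)) =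
      ∑ i, (fun g => b.coord i (π g)) * (fun g => β (b i) (π' g)) := by
    ext g
    conv_lhs => rw [← b.sum_repr (π g)]
    simp only [map_sum, map_smul, LinearMap.sum_apply, LinearMap.smul_apply, smul_eq_mul,
      Finset.sum_apply, Pi.mul_apply, Module.Basis.coord_apply]
  rw [this]
  refine Submodule.sum_mem _ fun i _ => Submodule.mul_mem_mul (coef_mem π _) (coef_mem π' _)

end

/-- inversion -/
lemma exists_kernel {ι : Type*} [Fintype ι] [DecidableEq ι] (C : Submodule ℂ (ι → ℂ)) (i : ι) :
    ∃ e ∈ C, ∀ f ∈ C, ∑ g, (starRingEnd ℂ) (e g) * f g = f i := by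
  let K : Submodule ℂ (EuclideanSpace ℂ ι) := C.comap (WithLp.linearEquiv 2 ℂ (ι → ℂ)).toLinearMap
  let d : EuclideanSpace ℂ ι := EuclideanSpace.single i 1
  refine ⟨(K.starProjection d).ofLp, ?_, ?_⟩
  · have : K.starProjection d ∈ K := Submodule.starProjection_apply_mem K d
    exact this
  · intro f hf
    have hf' : (WithLp.toLp 2 f : EuclideanSpace ℂ ι) ∈ K := hf
    have h1 : inner ℂ (d - K.starProjection d) (WithLp.toLp 2 f) = 0 :=
      Submodule.starProjection_inner_eq_zero d _ hf'
    rw [inner_sub_left, sub_eq_zero] at h1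
    have h2 : inner ℂ d (WithLp.toLp 2 f) = f i := by
      simp [d, EuclideanSpace.inner_single_left]
    rw [h2] at h1
    rw [h1]
    simp [PiLp.inner_apply, mul_comm]


end

section

section inv
variable {G : Type*} [Group G] [Fintype G] [DecidableEq G]

lemma inv_mem (hc : ∀ g : G, ∃ h, g⁻¹ = h * g * h⁻¹) (C : Submodule ℂ (G → ℂ))
    (hl : ∀ h, ∀ f ∈ C, (fun g => f (h * g)) ∈ C) (hr : ∀ h, ∀ f ∈ C, (fun g => f (g * h)) ∈ C)
    (f : G → ℂ) (hf : f ∈ C) : (fun g => f g⁻¹) ∈ C := by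
  obtain ⟨e, he, hk⟩ := exists_kernel C (1 : G)
  have uniq : ∀ e' ∈ C, (∀ f ∈ C, ∑ g, (starRingEnd ℂ) (e' g) * f g = f 1) → e' = e := by
    intro e' he' hk'
    have h0 : ∑ g, (starRingEnd ℂ) ((e' - e) g) * (e' - e) g = 0 := by
      have h1 := hk _ (C.sub_mem he' he)
      have h2 := hk' _ (C.sub_mem he' he)
      have : ∀ g, (starRingEnd ℂ) ((e' - e) g) * (e' - e) g =
        (starRingEnd ℂ) (e' g) * (e' - e) g - (starRingEnd ℂ) (e g) * (e' - e) g := by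
        intro g; simp [sub_mul]
      simp only [this, Finset.sum_sub_distrib]
      rw [h1, h2, sub_self]
    have h3 : ∑ g, ‖(e' - e) g‖ ^ 2 = (0 : ℝ) := by
      have : ((∑ g, ‖(e' - e) g‖ ^ 2 : ℝ) : ℂ) = 0 := by
        rw [← h0]
        push_cast
        refine Finset.sum_congr rfl fun g _ => ?_
        rw [Complex.conj_mul']
      exact_mod_cast this
    rw [Finset.sum_eq_zero_iff_of_nonneg (fun _ _ => by positivity)] at h3
    ext g
    have := h3 g (Finset.mem_univ _)
    have h4 : (e' - e) g = 0 := by simpa using this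
    simpa [sub_eq_zero] using h4
  have hcl : ∀ h g, e (h * g * h⁻¹) = e g := by
    intro h g
    have h1 : (fun g => e (h * g * h⁻¹)) ∈ C := by
      have := hr h⁻¹ _ (hl h e he)
      simpa [mul_assoc] using this
    have := uniq _ h1 (by
      intro f hf
      rw [← Equiv.sum_comp (MulAut.conj h⁻¹).toEquiv]
      have h2 : (fun g => f (h⁻¹ * g * h)) ∈ C := by
        have := hr h _ (hl h⁻¹ f hf)
        simpa [mul_assoc] using this
      have h3 := hk _ h2
      simp only [mul_one, inv_mul_cancel] at h3
      rw [← h3]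
      refine Finset.sum_congr rfl fun g _ => ?_
      simp [mul_assoc])
    exact congrFun this g
  have hshift : ∀ h, ∀ f ∈ C, f h = ∑ g, (starRingEnd ℂ) (e (h⁻¹ * g)) * f g := by
    intro h f hf
    have := hk _ (hl h f hf)
    simp only [mul_one] at this
    rw [← this, ← Equiv.sum_comp (Equiv.mulLeft h) (fun g => (starRingEnd ℂ) (e (h⁻¹ * g)) * f g)]
    simp
  have herm : ∀ h, (starRingEnd ℂ) (e h⁻¹) = e h := by
    intro h
    rw [hshift h⁻¹ e he, hshift h e he]
    simp only [map_sum, map_mul, inv_inv, Complex.conj_conj]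
    rw [← Equiv.sum_comp (Equiv.mulLeft h⁻¹)]
    simp [mul_comm]
  have hreal : ∀ h, (starRingEnd ℂ) (e h) = e h := by
    intro h
    obtain ⟨k, hk⟩ := hc h
    have := herm h
    rw [hk, hcl] at this
    exact this
  have : (fun g => f g⁻¹) = ∑ g, f g • (fun h => e (h * g)) := by
    ext h
    rw [hshift h⁻¹ f hf]
    simp [hreal, mul_comm]
  rw [this]
  exact Submodule.sum_mem _ fun g _ => Submodule.smul_mem _ _ (hr g e he)

end inv

variable {α : Type*} [Fintype α] [DecidableEq α] {R : Type*} [Ring R] [Algebra ℂ R]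

lemma perm_inv_conj (g : Perm α) : ∃ h, g⁻¹ = h * g * h⁻¹ := by
  have : IsConj g g⁻¹ := by
    rw [Equiv.Perm.isConj_iff_cycleType_eq, Equiv.Perm.cycleType_inv]
  obtain ⟨c, hc⟩ := isConj_iff.1 this
  exact ⟨c, hc.symm⟩

/-- multiplicative -/
def Mult {G R : Type*} [Mul G] [Mul R] (π : G → R) : Prop := ∀ g h, π (g * h) = π g * π h

lemma coef_inv_le {π : Perm α → R} (hm : Mult π) : coef (fun g => π g⁻¹) ≤ coef π := by
  rintro f ⟨l, hl⟩
  have : f = fun g => (fun g => l (π g)) g⁻¹ := by ext g; exact hl g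
  rw [this]
  refine inv_mem perm_inv_conj (coef π) ?_ ?_ (fun g => l (π g)) ?_
  · rintro h f ⟨l, hl⟩
    exact ⟨l ∘ₗ LinearMap.mulLeft ℂ (π h), fun g => by simp [hl, hm _ _]⟩
  · rintro h f ⟨l, hl⟩
    exact ⟨l ∘ₗ LinearMap.mulRight ℂ (π h), fun g => by simp [hl, hm _ _]⟩
  · exact coef_mem π l

lemma conj_mem [FiniteDimensional ℂ R] {π : Perm α → R} (hm : Mult π) (A : R) (l : R →ₗ[ℂ] ℂ) :
    (fun g => l (π g * A * π g⁻¹)) ∈ coef π ^ 2 := by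
  rw [pow_two]
  refine mul_le_mul_right (coef_inv_le hm) _ ?_
  have := bilin_mem π (fun g => π g⁻¹)
    ((LinearMap.mul ℂ R ∘ₗ LinearMap.mulRight ℂ A).compr₂ l)
  simpa using this

/-- Jucys–Murphy like sums -/
def X (π : Perm α → R) (a : α) : R := ∑ c, π (swap a c)

lemma conj_swap (g : Perm α) (a b : α) : g * swap a b * g⁻¹ = swap (g a) (g b) := by
  rw [Equiv.Perm.mul_def, Equiv.Perm.mul_def]
  ext x
  simp only [Equiv.trans_apply]
  have := Equiv.swap_apply_apply g a b
  rw [this]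
  simp

lemma pi_conj_swap {π : Perm α → R} (hm : Mult π) (g : Perm α) (a b : α) :
    π g * π (swap a b) * π g⁻¹ = π (swap (g a) (g b)) := by
  rw [← hm, ← hm, conj_swap]

lemma pi_conj_X {π : Perm α → R} (hm : Mult π) (g : Perm α) (a : α) :
    π g * X π a * π g⁻¹ = X π (g a) := by
  unfold X
  rw [Finset.mul_sum, Finset.sum_mul, ← Equiv.sum_comp g (fun c => π (swap (g a) c))]
  simp only [pi_conj_swap hm]

lemma pi_one_mul {π : Perm α → R} (hm : Mult π) (g : Perm α) : π 1 * π g = π g := by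
  rw [← hm, one_mul]
lemma pi_mul_one {π : Perm α → R} (hm : Mult π) (g : Perm α) : π g * π 1 = π g := by
  rw [← hm, mul_one]
lemma swap_sq {π : Perm α → R} (hm : Mult π) (a b : α) : π (swap a b) * π (swap a b) = π 1 := by
  rw [← hm, Equiv.swap_mul_self]
lemma X_one {π : Perm α → R} (hm : Mult π) (a : α) : X π a * π 1 = X π a := by
  unfold X
  rw [Finset.sum_mul]; simp only [pi_mul_one hm]
lemma one_X {π : Perm α → R} (hm : Mult π) (a : α) : π 1 * X π a = X π a := by
  unfold X
  rw [Finset.mul_sum]; simp only [pi_one_mul hm]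
lemma swap_X {π : Perm α → R} (hm : Mult π) (g : Perm α) (a : α) :
    π g * X π a = X π (g a) * π g := by
  rw [← pi_conj_X hm, mul_assoc, ← hm, inv_mul_cancel, mul_assoc, X_one hm]

def NR (π : Perm α → R) : Prop := ∀ a b, a ≠ b → X π a ≠ X π b
def NL1 (π : Perm α → R) : Prop := ∀ a b, a ≠ b → ∀ z w : ℂ, z • π 1 + w • π (swap a b) = 0 → z = 0 ∧ w = 0
def NL2 (π : Perm α → R) : Prop := ∀ a b c, a ≠ b → a ≠ c → b ≠ c → π (swap a b) ≠ π (swap a c)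

lemma exists_perm {k : ℕ} (f f' : Fin k → α) (hf : Function.Injective f) (hf' : Function.Injective f') :
    ∃ g : Perm α, ∀ i, g (f i) = f' i := by
  haveI : MulAction.IsPretransitive (Perm α) (Fin k ↪ α) := Equiv.Perm.isMultiplyPretransitive α k
  obtain ⟨g, hg⟩ := MulAction.exists_smul_eq (Perm α) (⟨f, hf⟩ : Fin k ↪ α) ⟨f', hf'⟩
  exact ⟨g, fun i => by simpa using DFunLike.congr_fun hg i⟩

lemma exists_perm2 {a b a' b' : α} (h : a ≠ b) (h' : a' ≠ b') : ∃ g : Perm α, g a = a' ∧ g b = b' := by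
  obtain ⟨g, hg⟩ := exists_perm ![a, b] ![a', b'] (by
    intro i j; fin_cases i <;> fin_cases j <;> simp [h, h.symm]) (by
    intro i j; fin_cases i <;> fin_cases j <;> simp [h', h'.symm])
  exact ⟨g, hg 0, hg 1⟩

lemma exists_perm3 {a b c a' b' c' : α} (h : a ≠ b) (h1 : a ≠ c) (h2 : b ≠ c) (h' : a' ≠ b')
    (h1' : a' ≠ c') (h2' : b' ≠ c') : ∃ g : Perm α, g a = a' ∧ g b = b' ∧ g c = c' := by
  obtain ⟨g, hg⟩ := exists_perm ![a, b, c] ![a', b', c'] (by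
    intro i j; fin_cases i <;> fin_cases j <;> simp [h, h.symm, h1, h1.symm, h2, h2.symm]) (by
    intro i j; fin_cases i <;> fin_cases j <;> simp [h', h'.symm, h1', h1'.symm, h2', h2'.symm])
  exact ⟨g, hg 0, hg 1, hg 2⟩

lemma not_NL2 {π : Perm α → R} (hm : Mult π) {a b c : α} (h : a ≠ b) (h1 : a ≠ c) (h2 : b ≠ c)
    (he : π (swap a b) = π (swap a c)) (x y z : α) (h' : x ≠ y) (h1' : x ≠ z) (h2' : y ≠ z) :
    π (swap x y) = π (swap x z) := by
  obtain ⟨g, rfl, rfl, rfl⟩ := exists_perm3 h h1 h2 h' h1' h2'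
  rw [← pi_conj_swap hm, ← pi_conj_swap hm, he]

lemma X_eq_of_not_NL2 {π : Perm α → R} (hm : Mult π) {a b c : α} (h : a ≠ b) (h1 : a ≠ c) (h2 : b ≠ c)
    (he : π (swap a b) = π (swap a c)) (x y : α) : X π x = X π y := by
  by_cases hxy : x = y
  · rw [hxy]
  unfold X
  rw [← Equiv.sum_comp (swap x y)]
  refine Finset.sum_congr rfl fun z _ => ?_
  by_cases hx : z = x
  · subst hx; simp [swap_comm]
  by_cases hy : z = y
  · subst hy; simp
  rw [swap_apply_of_ne_of_ne hx hy, swap_comm x z, swap_comm y z]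
  exact not_NL2 hm h h1 h2 he _ _ _ hx hy hxy

lemma exists_third (hc : 3 ≤ Fintype.card α) (a b : α) : ∃ c, c ≠ a ∧ c ≠ b := by
  by_contra hcon
  push Not at hcon
  have : (Finset.univ : Finset α) ⊆ {a, b} := by
    intro c _
    by_cases h : c = a
    · simp [h]
    · simp [hcon c h]
  have := Finset.card_le_card this
  have h2 := Finset.card_le_two (a := a) (b := b)
  rw [Finset.card_univ] at this
  omega

lemma exists_fourth (hc : 4 ≤ Fintype.card α) (a b c : α) : ∃ d, d ≠ a ∧ d ≠ b ∧ d ≠ c := by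
  by_contra hcon
  push Not at hcon
  have : (Finset.univ : Finset α) ⊆ {a, b, c} := by
    intro d _
    by_cases h : d = a
    · simp [h]
    by_cases h' : d = b
    · simp [h']
    · simp [hcon d h h']
  have := Finset.card_le_card this
  have h2 := Finset.card_le_three (a := a) (b := b) (c := c)
  rw [Finset.card_univ] at this
  omega

lemma NR.NL2 {π : Perm α → R} (hm : Mult π) (h : NR π) : NL2 π := by
  intro a b c h0 h1 h2 he
  exact h a b h0 (X_eq_of_not_NL2 hm h0 h1 h2 he a b)

lemma pi_zero {π : Perm α → R} (hm : Mult π) (h : π 1 = 0) (g : Perm α) : π g = 0 := by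
  rw [← pi_mul_one hm, h, mul_zero]

lemma NL2.NL1 {π : Perm α → R} (hm : Mult π) (hc : 3 ≤ Fintype.card α) (h : NL2 π) : NL1 π := by
  intro a b hab z w hzw
  obtain ⟨c, hca, hcb⟩ := exists_third hc a b
  have key := h a b c hab hca.symm hcb.symm
  have h1 : π 1 ≠ 0 := fun h0 => key (by rw [pi_zero hm h0, pi_zero hm h0])
  have hw : w = 0 := by
    by_contra hw
    apply key
    obtain ⟨g, hga, hgb⟩ := exists_perm2 hab hca.symm
    have e1 : π (swap a b) = (-w⁻¹ * z) • π 1 := by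
      have : w • π (swap a b) = -(z • π 1) := by rw [eq_neg_iff_add_eq_zero, add_comm]; exact hzw
      rw [mul_smul, neg_smul, ← smul_neg, ← this, smul_smul, inv_mul_cancel₀ hw, one_smul]
    have e2 := pi_conj_swap hm g a b
    rw [hga, hgb] at e2
    rw [← e2, e1]
    simp [← hm _ _]
  subst hw
  refine ⟨?_, rfl⟩
  simpa [h1] using hzw

lemma NR_of_NL2_three {π : Perm α → R} (hm : Mult π) (hc : Fintype.card α = 3) (h : NL2 π) : NR π := by
  intro a b hab he
  obtain ⟨c, hca, hcb⟩ := exists_third hc.ge a b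
  have hu : (Finset.univ : Finset α) = {a, b, c} := by
    symm
    apply Finset.eq_univ_of_card
    rw [hc, Finset.card_eq_three]
    exact ⟨a, b, c, hab, hca.symm, hcb.symm, rfl⟩
  unfold X at he
  rw [hu] at he
  rw [Finset.sum_insert (by simp [hab, hca.symm]), Finset.sum_insert (by simp [hcb.symm]),
    Finset.sum_singleton, Finset.sum_insert (by simp [hab, hca.symm]), Finset.sum_insert (by simp [hcb.symm]),
    Finset.sum_singleton] at he
  rw [swap_comm b a] at he
  simp only [swap_self, Equiv.Perm.one_def] at he
  have : π (swap a c) = π (swap b c) := by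
    have := he
    rw [← add_assoc, ← add_assoc, add_comm (π (swap a b))] at this
    exact add_left_cancel this
  rw [swap_comm a c, swap_comm b c] at this
  exact h c a b hca hcb hab this

/-- Lemma Z0 -/
lemma Z0 {π : Perm α → R} (hm : Mult π) {a b c d : α} (hab : a ≠ b) (hac : a ≠ c) (had : a ≠ d)
    (hbc : b ≠ c) (hbd : b ≠ d) (hcd : c ≠ d)
    (hZ : π (swap a c) + π (swap b d) = π (swap b c) + π (swap a d)) :
    π (swap a c) = π (swap b c) := by
  have two : ∀ x y : R, x + x = y + y → x = y := by
    intro x y h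
    have : (2:ℂ) • x = (2:ℂ) • y := by rw [two_smul, two_smul, h]
    exact smul_right_injective R (two_ne_zero' ℂ) this
  have c1 : swap b d * swap a c = swap a c * swap b d := by
    apply Equiv.Perm.Disjoint.commute
    rw [Equiv.Perm.disjoint_iff_disjoint_support, Equiv.Perm.support_swap hbd, Equiv.Perm.support_swap hac]
    simp [hab, hbc, hcd, had, hab.symm, hbc.symm, hcd.symm, had.symm]
  have c2 : swap a d * swap b c = swap b c * swap a d := by
    apply Equiv.Perm.Disjoint.commute
    rw [Equiv.Perm.disjoint_iff_disjoint_support, Equiv.Perm.support_swap had, Equiv.Perm.support_swap hbc]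
    simp [hab, hac, hbd, hcd, hab.symm, hac.symm, hbd.symm, hcd.symm]
  have sq : π (swap a c * swap b d) = π (swap b c * swap a d) := by
    have := congrArg (fun x => x * x) hZ
    simp only [add_mul, mul_add, swap_sq hm, ← hm _ _] at this
    rw [c1, c2] at this
    apply two
    have h2 : π 1 + π 1 + (π (swap a c * swap b d) + π (swap a c * swap b d)) =
      π 1 + π 1 + (π (swap b c * swap a d) + π (swap b c * swap a d)) := by
      convert this using 1 <;> abel
    exact add_left_cancel h2
  have e1 : π (swap a b * swap c d) = π 1 := by
    have h3 : swap a b * swap c d = (swap a c * swap b d) * (swap b c * swap a d) := by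
      ext x
      simp only [Equiv.Perm.mul_apply]
      by_cases xa : x = a
      · subst xa; simp [swap_apply_def, hab.symm, hac.symm, had.symm, hbc.symm, hbd.symm, hcd.symm, hab, hac, had, hbc, hbd, hcd]
      by_cases xb : x = b
      · subst xb; simp [swap_apply_def, hab.symm, hac.symm, had.symm, hbc.symm, hbd.symm, hcd.symm, hab, hac, had, hbc, hbd, hcd]
      by_cases xc : x = c
      · subst xc; simp [swap_apply_def, hab.symm, hac.symm, had.symm, hbc.symm, hbd.symm, hcd.symm, hab, hac, had, hbc, hbd, hcd]
      by_cases xd : x = d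
      · subst xd; simp [swap_apply_def, hab.symm, hac.symm, had.symm, hbc.symm, hbd.symm, hcd.symm, hab, hac, had, hbc, hbd, hcd]
      simp [swap_apply_of_ne_of_ne, xa, xb, xc, xd]
    rw [h3, hm, sq, ← hm]
    congr 1
    rw [mul_assoc, ← mul_assoc (swap a d), c2, mul_assoc (swap b c) (swap a d), swap_mul_self, mul_one, swap_mul_self]
  have e2 : π (swap a c * swap b d) = π 1 := by
    have h3 : swap a c * swap b d = swap b c * (swap a b * swap c d) * (swap b c)⁻¹ := by
      have := conj_swap (swap b c) a b
      have h' := conj_swap (swap b c) c d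
      rw [swap_apply_of_ne_of_ne hab hac, swap_apply_left] at this
      rw [swap_apply_right, swap_apply_of_ne_of_ne hbd.symm hcd.symm] at h'
      rw [← this, ← h']
      group
    rw [h3, hm, hm, e1, ← hm, ← hm]
    simp
  have e3 : π (swap a c) = π (swap b d) := by
    calc π (swap a c) = π (swap a c * swap b d) * π (swap b d) := by
          rw [← hm, mul_assoc, swap_mul_self, mul_one]
      _ = _ := by rw [e2, ← hm, one_mul]
  have e4 : π (swap b c) = π (swap a d) := by
    calc π (swap b c) = π (swap b c * swap a d) * π (swap a d) := by
          rw [← hm, mul_assoc, swap_mul_self, mul_one]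
      _ = _ := by rw [← sq, e2, ← hm, one_mul]
  rw [← e3, ← e4] at hZ
  exact two _ _ hZ


end

section
variable {α : Type*} [Fintype α] [DecidableEq α] {R : Type*} [Ring R] [Algebra ℂ R]

lemma swap_diff {M : Type*} [AddCommGroup M] [Module ℂ M] (w : α → ℂ) (v : α → M) (c d : α) (hcd : c ≠ d)
    (h1 : ∑ i, w i • v i = 0) (h2 : ∑ i, w i • v (swap c d i) = 0) :
    (w c - w d) • (v c - v d) = 0 := by
  have : ∑ i, w i • (v i - v (swap c d i)) = 0 := by
    simp only [smul_sub, Finset.sum_sub_distrib, h1, h2, sub_zero]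
  rw [Finset.sum_eq_add c d hcd (by
    rintro i - ⟨hi, hi'⟩
    rw [swap_apply_of_ne_of_ne hi hi', sub_self, smul_zero]) (by simp) (by simp)] at this
  rw [swap_apply_left, swap_apply_right] at this
  rw [← this, ← neg_sub (v c) (v d), smul_neg, sub_smul, sub_eq_add_neg]

lemma sum_two {M : Type*} [AddCommGroup M] [Module ℂ M] (s : α → α → ℂ) (hs : ∀ i j, s i j = s j i)
    (hd : ∀ i, s i i = 0) (m : α → α → M) (hm : ∀ i j, m i j = m j i) (a b : α) (hab : a ≠ b)
    (h1 : ∑ i, ∑ j, s i j • m i j = 0)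
    (h2 : ∑ i, ∑ j, s i j • m (swap a b i) (swap a b j) = 0) :
    ∑ j, (if j = a ∨ j = b then 0 else s a j - s b j) • (m a j - m b j) = 0 := by
  set E : α → α → M := fun i j => (s i j - s (swap a b i) (swap a b j)) • m i j with hE
  have hsum : ∑ j, ∑ i, E i j = 0 := by
    rw [Finset.sum_comm]
    simp only [hE, sub_smul, Finset.sum_sub_distrib, h1, zero_sub, neg_eq_zero]
    rw [← h2, ← Equiv.sum_comp (swap a b)]
    refine Finset.sum_congr rfl fun i _ => ?_
    rw [← Equiv.sum_comp (swap a b)]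
    simp
  have hEs : ∀ i j, E i j = E j i := by
    intro i j
    simp only [hE, hs i j, hs (swap a b i), hm i j]
  have hE0 : ∀ i j, i ≠ a → i ≠ b → j ≠ a → j ≠ b → E i j = 0 := by
    intro i j h1 h2 h3 h4
    simp only [hE, swap_apply_of_ne_of_ne h1 h2, swap_apply_of_ne_of_ne h3 h4, sub_self, zero_smul]
  have hEaa : ∀ i j, (i = a ∨ i = b) → (j = a ∨ j = b) → E i j = 0 := by
    rintro i j (rfl | rfl) (rfl | rfl) <;> simp [hE, hd, hs]
  set F : α → M := fun j => (if j = a ∨ j = b then (0:ℂ) else s a j - s b j) • (m a j - m b j) with hF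
  have hFE : ∀ j, F j = E a j + E b j := by
    intro j
    by_cases hj : j = a ∨ j = b
    · rw [hEaa a j (Or.inl rfl) hj, hEaa b j (Or.inr rfl) hj]
      simp [hF, hj]
    · have hj' := hj
      push Not at hj'
      simp only [hF, hj, if_false, hE, swap_apply_left, swap_apply_right,
        swap_apply_of_ne_of_ne hj'.1 hj'.2, smul_sub, sub_smul]
      abel
  have hcol : ∀ j, ∑ i, E i j = F j + (if j = a then ∑ i, E i a else 0) + (if j = b then ∑ i, E i b else 0) := by
    intro j
    by_cases hj : j = a
    · subst hj
      simp [hab, hF]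
    by_cases hj' : j = b
    · subst hj'
      simp [hab.symm, hF]
    simp only [hj, hj', if_false, add_zero, hFE]
    rw [Finset.sum_eq_add a b hab (by
      rintro i - ⟨hi, hi'⟩
      exact hE0 i j hi hi' hj hj') (by simp) (by simp)]
  rw [Finset.sum_congr rfl (fun j _ => hcol j)] at hsum
  simp only [Finset.sum_add_distrib, Finset.sum_ite_eq', Finset.mem_univ, if_true] at hsum
  have : ∑ i, E i a + ∑ i, E i b = ∑ j, F j := by
    rw [← Finset.sum_add_distrib]
    refine Finset.sum_congr rfl fun i _ => ?_
    rw [hFE, hEs i a, hEs i b]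
  rw [add_assoc, this, ← two_smul ℂ] at hsum
  exact (smul_eq_zero.1 hsum).resolve_left two_ne_zero

lemma sum_conj2 {π : Perm α → R} (hm : Mult π) (s : α → α → ℂ) (g : Perm α)
    (h : ∑ i, ∑ j, s i j • π (swap i j) = 0) : ∑ i, ∑ j, s i j • π (swap (g i) (g j)) = 0 := by
  have := congrArg (fun M => π g * M * π g⁻¹) h
  simp only [Finset.mul_sum, Finset.sum_mul, mul_smul_comm, smul_mul_assoc, pi_conj_swap hm, mul_zero,
    zero_mul] at this
  exact this

lemma four_term {π : Perm α → R} (hm : Mult π) (s : α → α → ℂ) (hs : ∀ i j, s i j = s j i)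
    (hd : ∀ i, s i i = 0) (h1 : ∑ i, ∑ j, s i j • π (swap i j) = 0)
    (hN : NL2 π) {a b c d : α} (hab : a ≠ b) (hac : a ≠ c) (had : a ≠ d)
    (hbc : b ≠ c) (hbd : b ≠ d) (hcd : c ≠ d) : s a c - s b c = s a d - s b d := by
  have hh := sum_two s hs hd (fun i j => π (swap i j)) (fun i j => by rw [swap_comm]) a b hab h1
    (sum_conj2 hm s _ h1)
  have hh2 := congrArg (fun M => π (swap c d) * M * π (swap c d)⁻¹) hh
  simp only [Finset.mul_sum, Finset.sum_mul, mul_smul_comm, smul_mul_assoc, mul_zero,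
    zero_mul, mul_sub, sub_mul, pi_conj_swap hm, swap_apply_of_ne_of_ne hac had,
    swap_apply_of_ne_of_ne hbc hbd] at hh2
  have := swap_diff _ (fun j => π (swap a j) - π (swap b j)) c d hcd hh hh2
  simp only [hac.symm, hbc.symm, had.symm, hbd.symm, or_self, if_false] at this
  rcases smul_eq_zero.1 this with h | h
  · exact sub_eq_zero.1 h
  · exfalso
    have hZ : π (swap a c) + π (swap b d) = π (swap b c) + π (swap a d) := by
      rw [sub_sub_sub_eq] at h
      rw [sub_eq_zero] at h
      rw [h, add_comm]
    have := Z0 hm hab hac had hbc hbd hcd hZ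
    rw [swap_comm a c, swap_comm b c] at this
    exact hN c a b hac.symm hbc.symm hab this

lemma s_solve {π : Perm α → R} (hm : Mult π) (s : α → α → ℂ) (hs : ∀ i j, s i j = s j i)
    (hd : ∀ i, s i i = 0) (h1 : ∑ i, ∑ j, s i j • π (swap i j) = 0)
    (hN : NL2 π) (ht : ∑ i, ∑ j, s i j = 0) (hc : 3 ≤ Fintype.card α) (b c : α) (hbc : b ≠ c) :
    ((Fintype.card α : ℂ) - 2) * s b c = ∑ j, s b j + ∑ j, s c j := by
  set n : ℂ := (Fintype.card α : ℂ) with hn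
  have cst : ∀ x : ℂ, ∑ j : α, x = n * x := by intro x; simp [hn]
  have key : ∀ a b c : α, a ≠ b → a ≠ c → b ≠ c → (n - 2) * (s a c - s b c) = ∑ j, s a j - ∑ j, s b j := by
    intro a b c hab hac hbc
    have : ∑ d, ((s a c - s b c) - (s a d - s b d)) = 
        ((s a c - s b c) - (s a a - s b a)) + ((s a c - s b c) - (s a b - s b b)) := by
      apply Finset.sum_eq_add a b hab _ (by simp) (by simp)
      rintro d - ⟨hda, hdb⟩
      by_cases hdc : d = c
      · subst hdc; ring
      rw [four_term hm s hs hd h1 hN hab hac (Ne.symm hda) hbc (Ne.symm hdb) (Ne.symm hdc), sub_self]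
    simp only [Finset.sum_sub_distrib, cst, hd] at this
    rw [hs b a] at this
    linear_combination this
  have key2 : ∀ a, (n - 2) * (s a c - s b c) - (∑ j, s a j - ∑ j, s b j) =
      if a = c then (n-2) * (- s b c) - (∑ j, s c j - ∑ j, s b j) else 0 := by
    intro a
    by_cases hac : a = c
    · subst hac; simp [hd]
    by_cases hab : a = b
    · subst hab; simp [hac]
    rw [key a b c hab hac hbc]; simp [hac]
  have := Finset.sum_congr rfl (fun a (_ : a ∈ Finset.univ) => key2 a)
  simp only [Finset.sum_sub_distrib, ← Finset.mul_sum, cst, ht, Finset.sum_ite_eq', Finset.mem_univ, if_true] at this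
  have hr : ∑ a, s a c = ∑ j, s c j := Finset.sum_congr rfl fun a _ => hs a c
  rw [hr] at this
  have hn1 : n - 1 ≠ 0 := by
    intro h
    have : (Fintype.card α : ℂ) = (1 : ℕ) := by push_cast; rw [← hn]; linear_combination h
    have := Nat.cast_injective this
    omega
  apply mul_left_cancel₀ hn1
  linear_combination -this

/-- B matrices -/
def B (π : Perm α → R) (i j : α) : R := (X π i - X π j) * π (swap i j)

lemma B_swap (π : Perm α → R) (i j : α) : B π j i = - B π i j := by
  unfold B; rw [swap_comm, ← neg_sub, neg_mul]

lemma B_row {π : Perm α → R} (hm : Mult π) (i : α) : ∑ k, B π i k = 0 := by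
  unfold B
  have : ∀ k, (X π i - X π k) * π (swap i k) = X π i * π (swap i k) - π (swap i k) * X π i := by
    intro k
    rw [swap_X hm, swap_apply_left, sub_mul]
  simp only [this, Finset.sum_sub_distrib, ← Finset.mul_sum, ← Finset.sum_mul]
  exact sub_self _

lemma pi_conj_B {π : Perm α → R} (hm : Mult π) (g : Perm α) (a b : α) :
    π g * B π a b * π g⁻¹ = B π (g a) (g b) := by
  unfold B
  rw [← pi_conj_swap hm, ← pi_conj_X hm, ← pi_conj_X hm, ← sub_mul, ← mul_sub]
  simp only [mul_assoc]
  rw [← mul_assoc (π g⁻¹) (π g), ← hm g⁻¹ g, inv_mul_cancel, ← mul_assoc (π 1), pi_one_mul hm]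

lemma tri_sum {M : Type*} [AddCommGroup M] [Module ℂ M] (f : α → α → M) (hf : ∀ i j, f j i = - f i j)
    (hr : ∀ i, ∑ k, f i k = 0) (hc : 3 ≤ Fintype.card α) (a b : α) (hab : a ≠ b)
    (h : ∀ d, d ≠ a → d ≠ b → f a b + f b d + f d a = 0) : f a b = 0 := by
  have hd0 : ∀ i, f i i = 0 := by
    intro i
    have := hf i i
    rw [eq_neg_iff_add_eq_zero, ← two_smul ℂ] at this
    exact (smul_eq_zero.1 this).resolve_left two_ne_zero
  have h2 : ∀ d, f a b + f b d + f d a = 0 := by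
    intro d
    by_cases hda : d = a
    · subst hda; rw [hf d b]; simp [hd0]
    by_cases hdb : d = b
    · subst hdb; rw [hf a d]; simp [hd0]
    exact h d hda hdb
  have h3 : ∑ d, (f a b + f b d + f d a) = 0 := by simp [h2]
  have h4 : ∑ d, f d a = 0 := by
    simp only [hf a, Finset.sum_neg_distrib, hr, neg_zero]
  rw [Finset.sum_add_distrib, Finset.sum_add_distrib, hr, h4, add_zero, add_zero, Finset.sum_const,
    Finset.card_univ, ← Nat.cast_smul_eq_nsmul ℂ] at h3
  refine (smul_eq_zero.1 h3).resolve_left ?_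
  exact_mod_cast (by omega)

lemma tri_ne {π : Perm α → R} (hm : Mult π) (hN : NR π) (hc : 3 ≤ Fintype.card α) {a b d : α}
    (hab : a ≠ b) (hda : d ≠ a) (hdb : d ≠ b) : B π a b + B π b d + B π d a ≠ 0 := by
  intro h
  have : B π a b = 0 := by
    apply tri_sum (B π) (B_swap π) (B_row hm) hc a b hab
    intro d' hda' hdb'
    have := congrArg (fun M => π (swap d d') * M * π (swap d d')⁻¹) h
    simp only [mul_add, add_mul, pi_conj_B hm, swap_apply_of_ne_of_ne (Ne.symm hda) (Ne.symm hda'),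
      swap_apply_of_ne_of_ne (Ne.symm hdb) (Ne.symm hdb'), swap_apply_left, mul_zero, zero_mul] at this
    exact this
  unfold B at this
  have := congrArg (fun M => M * π (swap a b)) this
  simp only [mul_assoc, swap_sq hm, zero_mul, sub_mul, X_one hm] at this
  exact hN a b hab (sub_eq_zero.1 this)

/-- antisymmetrisation -/
lemma anti3 {M : Type*} [AddCommGroup M] [Module ℂ M] (c : α → α → ℂ) (hcs : ∀ i j, c j i = - c i j)
    (m : α → α → M) (hm : ∀ i j, m j i = - m i j) (a b d : α) (hab : a ≠ b) (hda : d ≠ a) (hdb : d ≠ b)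
    (h : ∀ g : Perm α, ∑ i, ∑ j, c i j • m (g i) (g j) = 0) :
    (c a b + c b d + c d a) • (m a b + m b d + m d a) = 0 := by
  set c' : α → α → ℂ := fun i j => c i j - c (swap a b i) (swap a b j) - c (swap b d i) (swap b d j)
    - c (swap a d i) (swap a d j) + c (swap a b (swap b d i)) (swap a b (swap b d j))
    + c (swap b d (swap a b i)) (swap b d (swap a b j)) with hc'
  have hg : ∀ g : Perm α, ∑ i, ∑ j, c (g i) (g j) • m i j = 0 := by
    intro g
    rw [← h g⁻¹, ← Equiv.sum_comp g⁻¹]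
    refine Finset.sum_congr rfl fun i _ => ?_
    rw [← Equiv.sum_comp g⁻¹]
    simp
  have hsum : ∑ i, ∑ j, c' i j • m i j = 0 := by
    have h0 := hg 1
    have h1 := hg (swap a b)
    have h2 := hg (swap b d)
    have h3 := hg (swap a d)
    have h4 := hg (swap a b * swap b d)
    have h5 := hg (swap b d * swap a b)
    simp only [Perm.coe_one, id, Perm.mul_apply] at h0 h4 h5
    simp only [hc', sub_smul, add_smul, Finset.sum_sub_distrib, Finset.sum_add_distrib, h0, h1, h2, h3, h4, h5]
    simp
  have hd0 : ∀ i, c i i = 0 := by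
    intro i
    have := hcs i i
    linear_combination this / 2
  have hmd : ∀ i, m i i = 0 := by
    intro i
    have := hm i i
    rw [eq_neg_iff_add_eq_zero, ← two_smul ℂ] at this
    exact (smul_eq_zero.1 this).resolve_left two_ne_zero
  have ea : ∀ i, i ≠ a → i ≠ b → i ≠ d → ∀ j, c' i j = 0 := by
    intro i h1 h2 h3 j
    by_cases hja : j = a
    · subst hja
      simp only [hc', swap_apply_def, h1, h2, h3, hab, hda, hdb, hab.symm, hda.symm, hdb.symm, if_true, if_false]
      ring
    by_cases hjb : j = b
    · subst hjb
      simp only [hc', swap_apply_def, h1, h2, h3, hab, hda, hdb, hab.symm, hda.symm, hdb.symm, if_true, if_false]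
      ring
    by_cases hjd : j = d
    · subst hjd
      simp only [hc', swap_apply_def, h1, h2, h3, hab, hda, hdb, hab.symm, hda.symm, hdb.symm, if_true, if_false]
      ring
    simp only [hc', swap_apply_def, h1, h2, h3, hja, hjb, hjd, if_false]
    ring
  have anti : ∀ i j, c' j i = - c' i j := by
    intro i j
    simp only [hc']
    rw [hcs i j, hcs (swap a b i), hcs (swap b d i), hcs (swap a d i), hcs (swap a b (swap b d i)),
      hcs (swap b d (swap a b i))]
    ring
  have hS : ∀ f : α → M, (∀ i, i ≠ a → i ≠ b → i ≠ d → f i = 0) → ∑ i, f i = f a + f b + f d := by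
    intro f hf
    have : ∑ i, f i = ∑ i ∈ ({a, b, d} : Finset α), f i := by
      symm
      apply Finset.sum_subset (Finset.subset_univ _)
      intro i _ hi
      simp only [Finset.mem_insert, Finset.mem_singleton, not_or] at hi
      exact hf i hi.1 hi.2.1 hi.2.2
    rw [this, Finset.sum_insert (by simp [hab, hda.symm]), Finset.sum_insert (by simp [hdb.symm]),
      Finset.sum_singleton, add_assoc]
  rw [hS _ (fun i h1 h2 h3 => Finset.sum_eq_zero fun j _ => by rw [ea i h1 h2 h3, zero_smul])] at hsum
  have hr : ∀ i, ∑ j, c' i j • m i j = c' i a • m i a + c' i b • m i b + c' i d • m i d := by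
    intro i
    apply hS
    intro j h1 h2 h3
    have := anti j i
    rw [ea j h1 h2 h3, neg_zero] at this
    rw [this, zero_smul]
  simp only [hr, hmd, smul_zero] at hsum
  have v1 : c' a b = 2 * (c a b + c b d + c d a) := by
    simp only [hc', swap_apply_def, hab, hda, hdb, hab.symm, hda.symm, hdb.symm, if_true, if_false]
    rw [hcs a b, hcs d a, hcs b d]; ring
  have v2 : c' b d = 2 * (c a b + c b d + c d a) := by
    simp only [hc', swap_apply_def, hab, hda, hdb, hab.symm, hda.symm, hdb.symm, if_true, if_false]
    rw [hcs a b, hcs d a, hcs b d]; ring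
  have v3 : c' d a = 2 * (c a b + c b d + c d a) := by
    simp only [hc', swap_apply_def, hab, hda, hdb, hab.symm, hda.symm, hdb.symm, if_true, if_false]
    rw [hcs a b, hcs d a, hcs b d]; ring
  rw [anti a b, anti b d, anti d a, v1, v2, v3, hm a b, hm b d, hm d a] at hsum
  have : (4:ℂ) • ((c a b + c b d + c d a) • (m a b + m b d + m d a)) = 0 := by
    rw [← hsum]; module
  exact (smul_eq_zero.1 this).resolve_left (by norm_num)

lemma lemmaA_alg {π : Perm α → R} (hm : Mult π) (hN : NR π) (hc : 3 ≤ Fintype.card α) (c : α → α → ℂ)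
    (hd : ∀ i, c i i = 0) (h0 : ∑ i, ∑ j, c i j • π 1 = 0) (h1 : ∑ i, ∑ j, c i j • X π i = 0)
    (h2 : ∑ i, ∑ j, c i j • X π j = 0) (h3 : ∑ i, ∑ j, c i j • π (swap i j) = 0)
    (h4 : ∑ i, ∑ j, c i j • B π i j = 0) (i j : α) : c i j = 0 := by
  have hn0 : (Fintype.card α : ℂ) ≠ 0 := by exact_mod_cast (by omega)
  have hn2 : (Fintype.card α : ℂ) - 2 ≠ 0 := by
    intro h
    have : (Fintype.card α : ℂ) = (2 : ℕ) := by push_cast; linear_combination h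
    have := Nat.cast_injective this
    omega
  have hone : π 1 ≠ 0 := by
    intro h
    obtain ⟨a, b, hab⟩ := Fintype.exists_pair_of_one_lt_card (α := α) (by omega)
    apply hN a b hab
    unfold X
    simp [pi_zero hm h]
  have htot : ∑ i, ∑ j, c i j = 0 := by
    simp only [← Finset.sum_smul] at h0
    exact (smul_eq_zero.1 h0).resolve_right hone
  have aux : ∀ r : α → ℂ, ∑ i, r i = 0 → ∑ i, r i • X π i = 0 → ∀ i, r i = 0 := by
    intro r hr hX
    have hcon : ∀ a b, r a = r b := by
      intro a b
      by_cases hab : a = b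
      · rw [hab]
      have hX2 := congrArg (fun M => π (swap a b) * M * π (swap a b)⁻¹) hX
      simp only [Finset.mul_sum, Finset.sum_mul, mul_smul_comm, smul_mul_assoc, pi_conj_X hm, mul_zero,
        zero_mul] at hX2
      have := swap_diff r (X π) a b hab hX hX2
      exact sub_eq_zero.1 ((smul_eq_zero.1 this).resolve_right (sub_ne_zero.2 (hN a b hab)))
    intro i
    have : ∑ j, r j = ∑ j : α, r i := Finset.sum_congr rfl fun j _ => hcon j i
    rw [hr, Finset.sum_const, Finset.card_univ, nsmul_eq_mul] at this
    exact (mul_eq_zero.1 this.symm).resolve_left hn0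
  have hrow : ∀ i, ∑ j, c i j = 0 := by
    apply aux _ htot
    simpa only [Finset.sum_smul] using h1
  have hcol : ∀ j, ∑ i, c i j = 0 := by
    apply aux
    · rw [Finset.sum_comm]; exact htot
    · rw [Finset.sum_comm] at h2
      simpa only [Finset.sum_smul] using h2
  have anti : ∀ i j, c j i = - c i j := by
    intro i j
    by_cases hij : i = j
    · subst hij; simp [hd]
    have := s_solve hm (fun i j => c i j + c j i) (fun i j => add_comm _ _) (by simp [hd]) (by
      simp only [add_smul, Finset.sum_add_distrib]
      rw [h3, zero_add, Finset.sum_comm]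
      simpa only [swap_comm] using h3) (NR.NL2 hm hN) (by
      simp [Finset.sum_add_distrib, hrow, hcol]) hc i j hij
    simp only [Finset.sum_add_distrib, hrow, hcol, add_zero] at this
    have := (mul_eq_zero.1 this).resolve_left hn2
    linear_combination this
  by_cases hij : i = j
  · subst hij; exact hd i
  apply tri_sum c anti hrow hc i j hij
  intro d hdi hdj
  have := anti3 c anti (B π) (B_swap π) i j d hij hdi hdj (by
    intro g
    have := congrArg (fun M => π g * M * π g⁻¹) h4
    simpa only [Finset.mul_sum, Finset.sum_mul, mul_smul_comm, smul_mul_assoc, pi_conj_B hm, mul_zero,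
        zero_mul] using this)
  exact (smul_eq_zero.1 this).resolve_right (tri_ne hm hN hc hij hdi hdj)

lemma lemmaA [FiniteDimensional ℂ R] {π : Perm α → R} (hm : Mult π) (hN : NR π) (hc : 3 ≤ Fintype.card α)
    (x y : α) (hxy : x ≠ y) (u : α → α → ℂ) : (fun g : Perm α => u (g x) (g y)) ∈ coef π ^ 2 := by
  let S : Submodule ℂ (α × α → ℂ) :=
    (coef π ^ 2).comap (pull (fun g : Perm α => (g x, g y))).toLinearMap
  suffices h : (fun p : α × α => u p.1 p.2) ∈ S from h
  have hA : ∀ A : α → α → R, (∀ g : Perm α, π g * A x y * π g⁻¹ = A (g x) (g y)) → ∀ l : R →ₗ[ℂ] ℂ,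
      (fun p : α × α => l (A p.1 p.2)) ∈ S := by
    intro A hA l
    have := conj_mem hm (A x y) l
    simp only [hA] at this
    exact this
  apply mem_of_ann
  intro a ha
  have hA' : ∀ A : α → α → R, (∀ g : Perm α, π g * A x y * π g⁻¹ = A (g x) (g y)) →
      ∑ i, ∑ j, a (i, j) • A i j = 0 := by
    intro A h
    apply eq_zero_of_dual
    intro l
    have := ha _ (hA A h l)
    rw [Fintype.sum_prod_type] at this
    simpa using this
  have hz := lemmaA_alg hm hN hc (fun i j => a (i, j)) (by
      intro i
      have : (fun p : α × α => if p = (i, i) then (1:ℂ) else 0) ∈ S := by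
        have h0 : (fun g : Perm α => if (g x, g y) = (i, i) then (1:ℂ) else 0) = 0 := by
          ext g
          have : (g x, g y) ≠ (i, i) := by
            intro h
            rw [Prod.mk.injEq] at h
            exact hxy (g.injective (h.1.trans h.2.symm))
          simp only [this, if_false]; rfl
        change (fun g : Perm α => if (g x, g y) = (i, i) then (1:ℂ) else 0) ∈ coef π ^ 2
        rw [h0]; exact Submodule.zero_mem _
      simpa using ha _ this)
    (hA' (fun _ _ => π 1) (fun g => by simp [← hm _ _]))
    (hA' (fun i _ => X π i) (fun g => pi_conj_X hm g x))
    (hA' (fun _ j => X π j) (fun g => pi_conj_X hm g y))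
    (hA' (fun i j => π (swap i j)) (fun g => pi_conj_swap hm g x y))
    (hA' (fun i j => B π i j) (fun g => pi_conj_B hm g x y))
  apply Finset.sum_eq_zero
  rintro ⟨i, j⟩ -
  rw [hz i j, zero_mul]


end

section
section
variable {α : Type u} [Fintype α] [DecidableEq α] {R R' : Type*} [Ring R] [Algebra ℂ R] [Ring R'] [Algebra ℂ R']

lemma top_of_equiv {G H : Type*} [Group G] [Fintype G] [DecidableEq G] [Group H] [DecidableEq H]
    (e : H ≃* G) {K : Submodule ℂ (G → ℂ)} (hK : LInv K)
    (h : K.map (pull e).toLinearMap = ⊤) : K = ⊤ := by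
  rw [← one_mul K]
  refine top_of_support e.toMonoidHom e.injective LInv.one hK 1 (Submodule.one_le.1 le_rfl) rfl ?_ h
  intro g hg
  exact absurd ⟨e.symm g, e.apply_symm_apply g⟩ hg

/-- restriction to the complement of two letters -/
abbrev Sub2 (x y : α) := {z : α // z ≠ x ∧ z ≠ y}

def res (x y : α) (π : Perm α → R) : Perm (Sub2 x y) → R := fun h => π (Perm.ofSubtype h)

lemma res_mult {x y : α} {π : Perm α → R} (hm : Mult π) : Mult (res x y π) := by
  intro g h
  simp [res, hm _ _]

lemma res_swap (x y : α) (π : Perm α → R) (a b : Sub2 x y) : res x y π (swap a b) = π (swap a b) := by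
  rw [res, Perm.ofSubtype_swap_eq]

lemma res_one (x y : α) (π : Perm α → R) : res x y π 1 = π 1 := by
  simp [res]

lemma card_sub2 {x y : α} (hxy : x ≠ y) : Fintype.card (Sub2 x y) = Fintype.card α - 2 := by
  rw [Fintype.card_subtype]
  have : (Finset.univ.filter fun z => z ≠ x ∧ z ≠ y) = Finset.univ \ {x, y} := by
    ext z; simp
  rw [this, Finset.card_sdiff_of_subset (Finset.subset_univ _), Finset.card_univ, Finset.card_pair hxy]

lemma res_NL2 {π : Perm α → R} (h : NL2 π) (x y : α) : NL2 (res x y π) := by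
  intro a b c hab hac hbc
  rw [res_swap, res_swap]
  exact h _ _ _ (fun h => hab (Subtype.ext h)) (fun h => hac (Subtype.ext h)) (fun h => hbc (Subtype.ext h))

lemma res_NL1 {π : Perm α → R} (h : NL1 π) (x y : α) : NL1 (res x y π) := by
  intro a b hab z w
  rw [res_swap, res_one]
  exact h _ _ (fun h => hab (Subtype.ext h)) z w

lemma res_NR {π : Perm α → R} (hm : Mult π) (h : NL2 π) (hc : 5 ≤ Fintype.card α) (x y : α) (hxy : x ≠ y) :
    NR (res x y π) := by
  rintro ⟨a, ha⟩ ⟨b, hb⟩ hab he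
  have hab' : a ≠ b := fun h => hab (Subtype.ext h)
  obtain ⟨⟨e, hex, hey⟩, hea, heb⟩ := exists_third (by rw [card_sub2 hxy]; omega) (⟨a, ha⟩ : Sub2 x y) ⟨b, hb⟩
  have hea' : e ≠ a := fun h => hea (Subtype.ext h)
  have heb' : e ≠ b := fun h => heb (Subtype.ext h)
  have conv : ∀ f : α → R, ∑ c : Sub2 x y, f c = ∑ c, (if c ≠ x ∧ c ≠ y then (1:ℂ) else 0) • f c := by
    intro f
    simp only [ite_smul, one_smul, zero_smul]
    rw [← Finset.sum_filter]
    symm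
    apply Finset.sum_subtype
    simp
  have hs : ∑ c, (if c ≠ x ∧ c ≠ y then (1:ℂ) else 0) • (π (swap a c) - π (swap b c)) = 0 := by
    rw [← conv, Finset.sum_sub_distrib, sub_eq_zero]
    simpa only [X, res_swap] using he
  have hs2 := congrArg (fun M => π (swap e x) * M * π (swap e x)⁻¹) hs
  simp only [Finset.mul_sum, Finset.sum_mul, mul_smul_comm, smul_mul_assoc, mul_zero,
    zero_mul, mul_sub, sub_mul, pi_conj_swap hm, swap_apply_of_ne_of_ne (Ne.symm hea') ha.1,
    swap_apply_of_ne_of_ne (Ne.symm heb') hb.1] at hs2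
  have := swap_diff _ (fun j => π (swap a j) - π (swap b j)) e x hex hs hs2
  simp [hex, hey] at this
  have hZ : π (swap a e) + π (swap b x) = π (swap b e) + π (swap a x) := by
    rw [sub_sub_sub_eq] at this
    rw [sub_eq_zero] at this
    rw [this, add_comm]
  have := Z0 hm hab' hea'.symm ha.1 heb'.symm hb.1 hex hZ
  rw [swap_comm a e, swap_comm b e] at this
  exact h e a b hea' heb' hab' this

/-- transport along equivalence -/
lemma congr_swap {β : Type*} [DecidableEq β] (e : β ≃ α) (a b : β) : e.permCongr (swap a b) = swap (e a) (e b) := by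
  ext x
  simp [Equiv.permCongr_apply, Equiv.swap_apply_def, Equiv.symm_apply_eq]
  split_ifs <;> simp

lemma permCongr_one {β : Type*} (e : β ≃ α) : e.permCongr 1 = 1 := by ext; simp

lemma permCongr_mul' {β : Type*} (e : β ≃ α) (g h : Perm β) :
    e.permCongr (g * h) = e.permCongr g * e.permCongr h := by ext; simp

/-- base m = 2 -/
lemma base2 {W : Perm α → R} (hm : Mult W) (hc : Fintype.card α = 2) (hN : NL1 W) : coef W = ⊤ := by
  let e : Fin 2 ≃ α := (Fintype.equivFinOfCardEq hc).symm
  refine top_of_equiv (e.permCongrHom) (LInv.coef hm) ?_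
  rw [map_pull_coef]
  apply top_of_delta (LInv.coef (fun g h => by simp [hm _ _]))
  apply mem_of_ann
  intro a ha
  have := ann_coef _ a ha
  have hu : (Finset.univ : Finset (Perm (Fin 2))) = {1, swap 0 1} := by decide
  rw [hu, Finset.sum_insert (by decide), Finset.sum_singleton] at this
  have h2 := hN (e 0) (e 1) (by simp) (a 1) (a (swap 0 1)) (by
    rw [← this]
    simp only [Equiv.permCongrHom_coe, congr_swap, permCongr_one])
  simp [h2.1]

lemma delta3 {V : Perm (Fin 3) → R} (hm : Mult V) (c : Perm (Fin 3)) (hcc : c = swap 0 1 * swap 0 2 ∨ c = swap 0 2 * swap 0 1)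
    (hV : V c ≠ V 1) : (fun g => (if g = 1 then (1:ℂ) else 0) - (if g = c then 1 else 0)) ∈ coef V := by
  apply mem_of_ann
  intro a ha
  have h0 := ann_coef _ a ha
  have hu : (Finset.univ : Finset (Perm (Fin 3))) = {1, c, c * c, swap 0 1, swap 0 2, swap 1 2} := by
    rcases hcc with rfl | rfl <;> decide
  have sumu : ∀ f : Perm (Fin 3) → R, ∑ g, f g = f 1 + f c + f (c * c) + f (swap 0 1) + f (swap 0 2) + f (swap 1 2) := by
    intro f
    rw [hu, Finset.sum_insert (by rcases hcc with rfl | rfl <;> decide),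
      Finset.sum_insert (by rcases hcc with rfl | rfl <;> decide),
      Finset.sum_insert (by rcases hcc with rfl | rfl <;> decide),
      Finset.sum_insert (by rcases hcc with rfl | rfl <;> decide),
      Finset.sum_insert (by rcases hcc with rfl | rfl <;> decide), Finset.sum_singleton]
    abel
  have h1 := congrArg (fun M => V c * M * V c) h0
  simp only [Finset.mul_sum, Finset.sum_mul, mul_smul_comm, smul_mul_assoc, mul_zero, zero_mul, ← hm _ _] at h1
  rw [sumu] at h0 h1
  have t1 : c * swap 0 1 * c = swap 0 1 := by rcases hcc with rfl | rfl <;> decide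
  have t2 : c * swap 0 2 * c = swap 0 2 := by rcases hcc with rfl | rfl <;> decide
  have t3 : c * swap 1 2 * c = swap 1 2 := by rcases hcc with rfl | rfl <;> decide
  have t4 : c * c * c = 1 := by rcases hcc with rfl | rfl <;> decide
  have t5 : c * (c * c) * c = c := by rcases hcc with rfl | rfl <;> decide
  rw [t1, t2, t3, t4, t5, mul_one] at h1
  have h2 : (a c - a 1) • (V 1 - V c) + (a (c * c) - a 1) • (V c - V (c * c)) = 0 := by
    have := congrArg₂ (fun x y => x - y) h1 h0
    simp only [sub_zero] at this
    rw [← this]; module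
  have h3 := congrArg (fun M => V (swap 1 2) * M * V (swap 1 2)) h2
  have s1 : swap 1 2 * c * swap 1 2 = c * c := by rcases hcc with rfl | rfl <;> decide
  have s2 : swap 1 2 * (c * c) * swap 1 2 = c := by rcases hcc with rfl | rfl <;> decide
  simp only [mul_add, add_mul, mul_smul_comm, smul_mul_assoc, mul_zero, zero_mul, mul_sub, sub_mul, ← hm _ _, s1, s2,
    mul_one, swap_mul_self] at h3
  have h4 : (a c - a 1) • ((2:ℂ) • V 1 - V c - V (c * c)) = 0 := by
    have := congrArg₂ (fun x y => x + y) h2 h3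
    simp only [add_zero] at this
    rw [← this]; module
  have h5 : a c = a 1 := by
    rcases smul_eq_zero.1 h4 with h | h
    · exact sub_eq_zero.1 h
    · exfalso
      apply hV
      have h6 := congrArg (fun M => V c * M) h
      simp only [mul_sub, mul_smul_comm, ← hm _ _, mul_one, ← mul_assoc, t4, mul_zero] at h6
      have : (3:ℂ) • (V c - V 1) = 0 := by
        have := congrArg₂ (fun x y => x - y) h6 h
        simp only [sub_zero] at this
        rw [← this]; module
      exact sub_eq_zero.1 ((smul_eq_zero.1 this).resolve_left (by norm_num))
  have : ∀ g, a g * ((if g = 1 then (1:ℂ) else 0) - (if g = c then 1 else 0)) = (if g = 1 then a g else 0) - (if g = c then a g else 0) := by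
    intro g; split_ifs <;> simp
  simp only [this, Finset.sum_sub_distrib]
  simp [h5]

lemma NL2_comp {π : Perm α → R} (h : NL2 π) {β : Type*} [DecidableEq β] [Fintype β] (e : β ≃ α) :
    NL2 (fun g => π (e.permCongr g)) := by
  intro a b c hab hac hbc
  simp only [congr_swap]
  exact h _ _ _ (by simpa) (by simpa) (by simpa)

lemma key3 {U : Perm (Fin 3) → R} (hU : Mult U) (hN : NL2 U) (a b : Fin 3) (ha : 0 ≠ a) (hb : 0 ≠ b)
    (hab : a ≠ b) : U (swap 0 a * swap 0 b) ≠ U 1 := by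
  intro h
  apply hN 0 a b ha hb hab
  calc U (swap 0 a) = U (swap 0 a * swap 0 b) * U (swap 0 b) := by
        rw [← hU, mul_assoc, swap_mul_self, mul_one]
    _ = _ := by rw [h, ← hU, one_mul]

lemma base3 {V : Perm α → R} {W : Perm α → R'} (hV : Mult V) (hW : Mult W) (hc : Fintype.card α = 3)
    (hVN : NL2 V) (hWN : NL2 W) : coef V * coef W = ⊤ := by
  let e : Fin 3 ≃ α := (Fintype.equivFinOfCardEq hc).symm
  refine top_of_equiv (e.permCongrHom) ((LInv.coef hV).mul (LInv.coef hW)) ?_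
  rw [Submodule.map_mul, map_pull_coef, map_pull_coef]
  simp only [Equiv.permCongrHom_coe]
  have mV : Mult (fun g => V (e.permCongr g)) := fun g h => by simp only [permCongr_mul', hV _ _]
  have mW : Mult (fun g => W (e.permCongr g)) := fun g h => by simp only [permCongr_mul', hW _ _]
  apply top_of_delta ((LInv.coef (fun g h => mV g h)).mul (LInv.coef (fun g h => mW g h)))
  have d1 := delta3 mV (swap 0 1 * swap 0 2) (Or.inl rfl) (key3 mV (NL2_comp hVN e) 1 2 (by decide) (by decide) (by decide))
  have d2 := delta3 mW (swap 0 2 * swap 0 1) (Or.inr rfl) (key3 mW (NL2_comp hWN e) 2 1 (by decide) (by decide) (by decide))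
  have := Submodule.mul_mem_mul d1 d2
  convert this using 1
  ext g
  simp only [Pi.mul_apply]
  have n1 : (1 : Perm (Fin 3)) ≠ swap 0 1 * swap 0 2 := by decide
  have n2 : (1 : Perm (Fin 3)) ≠ swap 0 2 * swap 0 1 := by decide
  have n3 : (swap 0 1 * swap 0 2 : Perm (Fin 3)) ≠ swap 0 2 * swap 0 1 := by decide
  by_cases h1 : g = 1
  · subst h1; simp only [if_true, n1, n2, if_false]; simp
  by_cases h2 : g = swap 0 1 * swap 0 2
  · subst h2; simp only [if_true, n1.symm, n3, if_false]; simp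
  simp only [h1, h2, if_false]; simp

/-- stabiliser indicator -/
lemma ind_mem [FiniteDimensional ℂ R] {π : Perm α → R} (hm : Mult π) (hN : NR π) (hc : 3 ≤ Fintype.card α)
    (x y : α) (hxy : x ≠ y) : (fun g : Perm α => if g x = x ∧ g y = y then (1:ℂ) else 0) ∈ coef π ^ 2 :=
  lemmaA hm hN hc x y hxy (fun i j => if i = x ∧ j = y then 1 else 0)

lemma mem_range_ofSubtype {x y : α} (g : Perm α) (hx : g x = x) (hy : g y = y) :
    g ∈ Set.range (Perm.ofSubtype : Perm (Sub2 x y) →* Perm α) := by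
  have h1 : ∀ z, (g z ≠ x ∧ g z ≠ y) ↔ (z ≠ x ∧ z ≠ y) := by
    intro z
    constructor
    · rintro ⟨h, h'⟩
      exact ⟨fun e => h (by rw [e, hx]), fun e => h' (by rw [e, hy])⟩
    · rintro ⟨h, h'⟩
      exact ⟨fun e => h (g.injective (by rw [e, hx])), fun e => h' (g.injective (by rw [e, hy]))⟩
  refine ⟨g.subtypePerm h1, Perm.ofSubtype_subtypePerm h1 ?_⟩
  intro z hz
  exact ⟨fun e => hz (by rw [e, hx]), fun e => hz (by rw [e, hy])⟩

lemma top_step [FiniteDimensional ℂ R] {π : Perm α → R} (hm : Mult π) (hN : NR π) (hc : 3 ≤ Fintype.card α)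
    (x y : α) (hxy : x ≠ y) {K : Submodule ℂ (Perm α → ℂ)} (hK : LInv K)
    (h : K.map (pull (Perm.ofSubtype : Perm (Sub2 x y) →* Perm α)).toLinearMap = ⊤) :
    coef π ^ 2 * K = ⊤ := by
  refine top_of_support (Perm.ofSubtype : Perm (Sub2 x y) →* Perm α) Perm.ofSubtype_injective
    ((LInv.coef hm).pow 2) hK _ (ind_mem hm hN hc x y hxy) (by simp) ?_ h
  intro g hg
  rw [if_neg]
  rintro ⟨h1, h2⟩
  exact hg (mem_range_ofSubtype g h1 h2)

lemma map_pull_res {H : Type*} (x y : α) (π : Perm α → R) :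
   (coef π).map (pull (Perm.ofSubtype : Perm (Sub2 x y) →* Perm α)).toLinearMap = coef (res x y π) :=
  map_pull_coef _ _

end

theorem Pm {R R' : Type*} [Ring R] [Algebra ℂ R] [Ring R'] [Algebra ℂ R'] [FiniteDimensional ℂ R] (m : ℕ) :
    ∀ (α : Type u) [Fintype α] [DecidableEq α], Fintype.card α = m → 2 ≤ m →
    ∀ (V : Perm α → R) (W : Perm α → R'), Mult V → Mult W → NL1 W → NL2 W → (3 ≤ m → NR V) →
    coef V ^ (m - 2) * coef W = ⊤ := by
  induction m using Nat.strong_induction_on with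
  | _ m ih =>
    intro α _ _ hc hm2 V W hV hW h1 h2 hN
    by_cases hm : m = 2
    · subst hm
      simp [base2 hW hc h1]
    by_cases hm3 : m = 3
    · subst hm3
      simp [base3 hV hW hc (NR.NL2 hV (hN le_rfl)) h2]
    obtain ⟨x, y, hxy⟩ := Fintype.exists_pair_of_one_lt_card (α := α) (by omega)
    have e : m - 2 = 2 + (m - 2 - 2) := by omega
    rw [e, pow_add, mul_assoc]
    apply top_step hV (hN (by omega)) (by omega) x y hxy (((LInv.coef hV).pow _).mul (LInv.coef hW))
    rw [Submodule.map_mul, Submodule.map_pow, map_pull_coef, map_pull_coef]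
    refine ih (m - 2) (by omega) (Sub2 x y) (by rw [card_sub2 hxy, hc]) (by omega) (res x y V) (res x y W)
      (res_mult hV) (res_mult hW) (res_NL1 h1 x y) (res_NL2 h2 x y) ?_
    intro hm5
    exact res_NR hV (NR.NL2 hV (hN (by omega))) (by omega) x y hxy

theorem Pm2 {R R' : Type*} [Ring R] [Algebra ℂ R] [Ring R'] [Algebra ℂ R'] [FiniteDimensional ℂ R]
    [FiniteDimensional ℂ R']
    (α : Type u) [Fintype α] [DecidableEq α] (hc : 3 ≤ Fintype.card α)
    (V : Perm α → R) (W : Perm α → R') (hV : Mult V) (hW : Mult W) (hVN : NR V) (hWN : NR W) :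
    coef V ^ 2 * coef W ^ (Fintype.card α - 3) = ⊤ := by
  by_cases hm3 : Fintype.card α = 3
  · simp [hm3, pow_two, base3 hV hV hm3 (NR.NL2 hV hVN) (NR.NL2 hV hVN)]
  obtain ⟨x, y, hxy⟩ := Fintype.exists_pair_of_one_lt_card (α := α) (by omega)
  apply top_step hV hVN (by omega) x y hxy ((LInv.coef hW).pow _)
  rw [Submodule.map_pow, map_pull_coef]
  have hN := NR.NL2 hW hWN
  have h := Pm (R := R') (R' := R') (Fintype.card α - 2) (Sub2 x y) (card_sub2 hxy) (by omega) (res x y W) (res x y W) (res_mult hW) (res_mult hW)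
    (res_NL1 (NL2.NL1 hW hc hN) x y) (res_NL2 hN x y) (fun _ => res_NR hW hN (by omega) x y hxy)
  rw [← pow_succ] at h
  have e : Fintype.card α - 3 = Fintype.card α - 2 - 2 + 1 := by omega
  rw [e]
  exact h


end

section
variable {α : Type u} [Fintype α] [DecidableEq α] {R R' : Type*} [Ring R] [Algebra ℂ R] [Ring R'] [Algebra ℂ R']

structure Irr (π : Perm α → R) : Prop where
  mult : Mult π
  one : π 1 = 1
  schur : ∀ z : R, (∀ g, z * π g = π g * z) → ∃ x : ℂ, z = x • (1 : R)
  lin : ∀ f : R, (∀ g, ∃ c : ℂ, π g * f = c • f) → f = 0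

lemma Irr.lin_swap {π : Perm α → R} (h : Irr π) (ε : ℂ) (f : R)
    (hf : ∀ a b, a ≠ b → π (swap a b) * f = ε • f) : f = 0 := by
  apply h.lin
  intro g
  induction g using Equiv.Perm.swap_induction_on with
  | one => exact ⟨1, by rw [h.one, one_mul, one_smul]⟩
  | swap_mul g x y hxy ih =>
    obtain ⟨c, hc⟩ := ih
    exact ⟨c * ε, by rw [h.mult, mul_assoc, hc, mul_smul_comm, hf x y hxy, smul_smul]⟩

lemma all_eq {β : Type*} {M : Type*} (t : β → β → M) (hs : ∀ a b, t a b = t b a)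
    (h : ∀ a b c, a ≠ b → a ≠ c → b ≠ c → t a b = t a c) (a b c d : β) (hab : a ≠ b) (hcd : c ≠ d) :
    t a b = t c d := by
  have h' : ∀ a b c, a ≠ b → a ≠ c → t a b = t a c := by
    intro a b c h1 h2
    by_cases h3 : b = c
    · rw [h3]
    exact h a b c h1 h2 h3
  by_cases hac : a = c
  · subst hac; exact h' a b d hab hcd
  rw [h' a b c hab hac, hs a c]
  exact h' c a d (Ne.symm hac) hcd

lemma Irr.NL2 [Nontrivial R] {π : Perm α → R} (h : Irr π) (hc : 3 ≤ Fintype.card α) : NL2 π := by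
  intro a b c hab hac hbc he
  have hall := all_eq (fun a b => π (swap a b)) (fun a b => by rw [swap_comm]) (not_NL2 h.mult hab hac hbc he)
  have h1 : (1 : R) + π (swap a b) = 0 := by
    apply h.lin_swap 1
    intro x y hxy
    rw [hall x y a b hxy hab, mul_add, swap_sq h.mult, h.one, mul_one, one_smul, add_comm]
  have h2 : (1 : R) = 0 := by
    apply h.lin_swap (-1)
    intro x y hxy
    rw [hall x y a b hxy hab, mul_one, neg_smul, one_smul]
    rw [add_comm] at h1
    exact eq_neg_of_add_eq_zero_left h1
  exact one_ne_zero h2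

lemma not_NR {π : Perm α → R} (hm : Mult π) (h : ¬ NR π) (a b : α) : X π a = X π b := by
  by_cases hab : a = b
  · rw [hab]
  unfold NR at h
  push Not at h
  obtain ⟨x, y, hxy, he⟩ := h
  obtain ⟨g, rfl, rfl⟩ := exists_perm2 hxy hab
  rw [← pi_conj_X hm, ← pi_conj_X hm, he]

lemma Irr.rect {π : Perm α → R} (h : Irr π) (hN : ¬ NR π) : ∃ x : ℂ, ∀ a, X π a = x • (1 : R) := by
  by_cases hα : Nonempty α
  · obtain ⟨a⟩ := hα
    obtain ⟨x, hx⟩ := h.schur (X π a) (fun g => by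
      rw [swap_X h.mult, not_NR h.mult hN (g a) a])
    exact ⟨x, fun b => by rw [not_NR h.mult hN b a, hx]⟩
  · exact ⟨0, fun a => absurd ⟨a⟩ hα⟩

def yy (π : Perm α → R) (ε : ℂ) (a b : α) : R := 1 + ε • π (swap a b)

lemma yy_comm (π : Perm α → R) (ε : ℂ) (a b : α) : yy π ε a b = yy π ε b a := by
  unfold yy; rw [swap_comm]

lemma conj_yy {π : Perm α → R} (h : Mult π) (h1 : π 1 = 1) (ε : ℂ) (g : Perm α) (a b : α) :
    π g * yy π ε a b * π g⁻¹ = yy π ε (g a) (g b) := by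
  unfold yy
  rw [mul_add, add_mul, mul_smul_comm, smul_mul_assoc, pi_conj_swap h, mul_one, ← h, mul_inv_cancel, h1]

lemma swap_yy {π : Perm α → R} (h : Mult π) (h1 : π 1 = 1) {ε : ℂ} (hε : ε * ε = 1) (a b : α) :
    π (swap a b) * yy π ε a b = ε • yy π ε a b := by
  unfold yy
  rw [mul_add, mul_smul_comm, swap_sq h, h1, mul_one, smul_add, smul_smul, hε, one_smul, add_comm]

lemma yy_swap {π : Perm α → R} (h : Mult π) (h1 : π 1 = 1) {ε : ℂ} (hε : ε * ε = 1) (a b : α) :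
    yy π ε a b * π (swap a b) = ε • yy π ε a b := by
  unfold yy
  rw [add_mul, smul_mul_assoc, swap_sq h, h1, one_mul, smul_add, smul_smul, hε, one_smul, add_comm]

lemma yy_sq {π : Perm α → R} (h : Mult π) (h1 : π 1 = 1) {ε : ℂ} (hε : ε * ε = 1) (a b : α) :
    yy π ε a b * yy π ε a b = (2:ℂ) • yy π ε a b := by
  conv_lhs => arg 1; unfold yy
  rw [add_mul, one_mul, smul_mul_assoc, swap_yy h h1 hε, smul_smul, hε, one_smul, two_smul]

lemma yy_commute {π : Perm α → R} (h : Mult π) (ε ε' : ℂ) {a b c d : α}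
    (hac : a ≠ c) (had : a ≠ d) (hbc : b ≠ c) (hbd : b ≠ d) :
    yy π ε a b * yy π ε' c d = yy π ε' c d * yy π ε a b := by
  have : π (swap a b) * π (swap c d) = π (swap c d) * π (swap a b) := by
    have h2 := pi_conj_swap h (swap a b) c d
    rw [swap_apply_of_ne_of_ne hac.symm hbc.symm, swap_apply_of_ne_of_ne had.symm hbd.symm] at h2
    conv_rhs => rw [← h2, mul_assoc, ← h (swap a b)⁻¹ (swap a b), inv_mul_cancel, mul_assoc, pi_mul_one h]
  unfold yy
  simp only [mul_add, add_mul, mul_one, one_mul, smul_mul_assoc, mul_smul_comm, this]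
  module

/-- Lemma Y -/
lemma lemmaY {π : Perm α → R} (h : Mult π) (h1 : π 1 = 1) (x : ℂ) (hX : ∀ a, X π a = x • (1 : R))
    (hc : 5 ≤ Fintype.card α) {ε : ℂ} (hε : ε * ε = 1)
    (h0 : ∀ a b c d : α, a ≠ b → a ≠ c → a ≠ d → b ≠ c → b ≠ d → c ≠ d → yy π ε a b * yy π ε c d = 0)
    (a b : α) (hab : a ≠ b) : yy π ε a b = 0 := by
  by_contra hne
  set n : ℂ := (Fintype.card α : ℂ) with hn
  set y := yy π ε a b with hy
  have hyy : y * y = (2:ℂ) • y := yy_sq h h1 hε a b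
  have self : ∀ k, yy π ε k k = (1 + ε) • (1:R) := by
    intro k; unfold yy; rw [swap_self, ← Perm.one_def, h1, add_smul, one_smul]
  -- full sums
  have full : ∀ k, ∑ j, yy π ε k j = (n + ε * x) • (1:R) := by
    intro k
    unfold yy
    rw [Finset.sum_add_distrib, ← Finset.smul_sum]
    have := hX k
    unfold X at this
    rw [this, Finset.sum_const, Finset.card_univ, ← Nat.cast_smul_eq_nsmul ℂ, smul_smul, add_smul]
  set η : ℂ := n + ε * x - (1 + ε) with hη
  have hk : ∀ k, k ≠ a → k ≠ b → y * (yy π ε a k + yy π ε b k) = η • y := by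
    intro k hka hkb
    have e1 : ∑ j, y * yy π ε k j = (n + ε * x) • y := by
      rw [← Finset.mul_sum, full, mul_smul_comm, mul_one]
    have e2 : ∑ j, (y * yy π ε k j - if j = k then (1 + ε) • y else 0) = y * yy π ε k a + y * yy π ε k b := by
      rw [Finset.sum_eq_add a b hab _ (by simp) (by simp)]
      · simp [Ne.symm hka, Ne.symm hkb]
      · rintro j - ⟨hja, hjb⟩
        by_cases hjk : j = k
        · subst hjk; rw [self, mul_smul_comm, mul_one]; simp
        · rw [hy, h0 a b k j hab (Ne.symm hka) (Ne.symm hja) (Ne.symm hkb) (Ne.symm hjb) (Ne.symm hjk)]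
          simp [hjk]
    rw [Finset.sum_sub_distrib, e1, Finset.sum_ite_eq', if_pos (Finset.mem_univ _)] at e2
    rw [mul_add, yy_comm π ε a k, yy_comm π ε b k, ← e2, hη, sub_smul]
  have hlin : (4 + (n - 4) * η) • y = 0 := by
    have e1 : ∑ k, y * (yy π ε a k + yy π ε b k) = (2 * (n + ε * x)) • y := by
      rw [← Finset.mul_sum, Finset.sum_add_distrib, full, full, ← two_smul ℂ, smul_smul, mul_smul_comm, mul_one]
    have e2 : ∑ k, (y * (yy π ε a k + yy π ε b k) - η • y) = 
      (y * (yy π ε a a + yy π ε b a) - η • y) + (y * (yy π ε a b + yy π ε b b) - η • y) := by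
      apply Finset.sum_eq_add a b hab _ (by simp) (by simp)
      rintro k - ⟨hka, hkb⟩
      rw [hk k hka hkb, sub_self]
    rw [Finset.sum_sub_distrib, e1, self, self, yy_comm π ε b a, ← hy, mul_add y _ y, mul_add y y _, hyy, mul_smul_comm, mul_one,
      Finset.sum_const, Finset.card_univ, ← Nat.cast_smul_eq_nsmul ℂ, ← hn] at e2
    have e3 := sub_eq_zero.2 e2
    rw [← neg_eq_zero, ← e3, hη]
    module
  have hlin' : 4 + (n - 4) * η = 0 := (smul_eq_zero.1 hlin).resolve_right hne
  obtain ⟨k, hka, hkb⟩ := exists_third (by omega) a b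
  have q1 : y * yy π ε a k * y = η • y := by
    have e1 := congrArg (fun M => M * y) (hk k hka hkb)
    simp only [mul_add, add_mul, smul_mul_assoc, hyy] at e1
    have e2 : y * yy π ε b k * y = y * yy π ε a k * y := by
      have := conj_yy h h1 ε (swap a b) a k
      rw [swap_apply_left, swap_apply_of_ne_of_ne hka hkb, swap_inv] at this
      rw [← this]
      have l := yy_swap h h1 hε a b
      have r := swap_yy h h1 hε a b
      rw [← hy] at l r
      calc y * (π (swap a b) * yy π ε a k * π (swap a b)) * y 
          = (y * π (swap a b)) * yy π ε a k * (π (swap a b) * y) := by simp only [mul_assoc]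
        _ = (ε * ε) • (y * yy π ε a k * y) := by
            rw [l, r]; simp only [smul_mul_assoc, mul_smul_comm, smul_smul]
        _ = _ := by rw [hε, one_smul]
    rw [e2, ← two_smul ℂ, smul_smul, mul_comm η 2, mul_smul] at e1
    exact smul_right_injective R (two_ne_zero' ℂ) e1
  have q1' : y * yy π ε b k * y = η • y := by
    have e1 := congrArg (fun M => M * y) (hk k hka hkb)
    simp only [mul_add, add_mul, smul_mul_assoc, hyy] at e1
    rw [q1] at e1
    have : y * yy π ε b k * y = η • (2:ℂ) • y - η • y := by rw [← e1]; abel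
    rw [this]; module
  have q2 : y * π (swap a k) * y = (ε * (η - 2)) • y := by
    unfold yy at q1
    rw [mul_add, add_mul, mul_one, hyy, mul_smul_comm, smul_mul_assoc] at q1
    have : ε • (y * π (swap a k) * y) = (η - 2) • y := by
      rw [sub_smul, ← q1]; abel
    rw [mul_smul, ← this, smul_smul, hε, one_smul]
  have q3 : (2 * (η - 2) ^ 2 - 2 * η) • y = 0 := by
    have e1 : (y * π (swap a k) * y) * (y * π (swap a k) * y) = (2 * (η - 2)^2) • y := by
      rw [q2, smul_mul_smul_comm, hyy, smul_smul]
      congr 1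
      linear_combination (2 * (η - 2)^2) * hε
    have e2 : (y * π (swap a k) * y) * (y * π (swap a k) * y) = (2 * η) • y := by
      have := conj_yy h h1 ε (swap a k) a b
      rw [swap_apply_left, swap_apply_of_ne_of_ne hab.symm (Ne.symm hkb), swap_inv, ← hy, yy_comm] at this
      calc _ = y * π (swap a k) * (y * y) * π (swap a k) * y := by simp only [mul_assoc]
        _ = (2:ℂ) • (y * (π (swap a k) * y * π (swap a k)) * y) := by
            rw [hyy]; simp only [mul_assoc, mul_smul_comm, smul_mul_assoc]
        _ = _ := by rw [this, q1', smul_smul]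
    rw [sub_smul, ← e1, e2, sub_self]
  have q4 := (smul_eq_zero.1 q3).resolve_right hne
  have q5 : (η - 1) * (η - 4) = 0 := by linear_combination q4 / 2
  rcases mul_eq_zero.1 q5 with q | q
  · have : n = 0 := by linear_combination hlin' - (n - 4) * q
    rw [hn] at this
    have : Fintype.card α = 0 := by exact_mod_cast this
    omega
  · have : n = 3 := by linear_combination hlin' / 4 - (n - 4) / 4 * q
    rw [hn] at this
    have : Fintype.card α = 3 := by exact_mod_cast this
    omega

lemma exists_perm4 {a b c d a' b' c' d' : α} (h : a ≠ b) (h1 : a ≠ c) (h2 : a ≠ d) (h3 : b ≠ c) (h4 : b ≠ d) (h5 : c ≠ d)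
    (h' : a' ≠ b') (h1' : a' ≠ c') (h2' : a' ≠ d') (h3' : b' ≠ c') (h4' : b' ≠ d') (h5' : c' ≠ d') :
    ∃ g : Perm α, g a = a' ∧ g b = b' ∧ g c = c' ∧ g d = d' := by
  obtain ⟨g, hg⟩ := exists_perm ![a, b, c, d] ![a', b', c', d'] (by
    intro i j; fin_cases i <;> fin_cases j <;> simp [h, h.symm, h1, h1.symm, h2, h2.symm, h3, h3.symm, h4, h4.symm, h5, h5.symm]) (by
    intro i j; fin_cases i <;> fin_cases j <;> simp [h', h'.symm, h1', h1'.symm, h2', h2'.symm, h3', h3'.symm, h4', h4'.symm, h5', h5'.symm])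
  exact ⟨g, hg 0, hg 1, hg 2, hg 3⟩

/-- R0 -/
lemma R0 [Nontrivial R] {π : Perm α → R} (h : Irr π) (hN : ¬ NR π) (hc : 5 ≤ Fintype.card α) {ε : ℂ} (hε : ε * ε = 1)
    {a b c d : α} (hab : a ≠ b) (hac : a ≠ c) (had : a ≠ d) (hbc : b ≠ c) (hbd : b ≠ d) (hcd : c ≠ d) :
    yy π ε a b * yy π ε c d ≠ 0 := by
  intro h0
  obtain ⟨x, hx⟩ := h.rect hN
  have hall : ∀ a b c d : α, a ≠ b → a ≠ c → a ≠ d → b ≠ c → b ≠ d → c ≠ d → yy π ε a b * yy π ε c d = 0 := by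
    intro a' b' c' d' h1 h2 h3 h4 h5 h6
    obtain ⟨g, rfl, rfl, rfl, rfl⟩ := exists_perm4 hab hac had hbc hbd hcd h1 h2 h3 h4 h5 h6
    rw [← conj_yy h.mult h.one, ← conj_yy h.mult h.one]
    calc _ = π g * yy π ε a b * (π g⁻¹ * π g) * yy π ε c d * π g⁻¹ := by simp only [mul_assoc]
      _ = π g * (yy π ε a b * yy π ε c d) * π g⁻¹ := by
          rw [← h.mult, inv_mul_cancel, h.one, mul_one]; simp only [mul_assoc]
      _ = 0 := by rw [h0]; simp
  have hy := lemmaY h.mult h.one x hx hc hε hall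
  have h2 : (1 : R) = 0 := by
    apply h.lin_swap (-ε)
    intro u v huv
    have := hy u v huv
    unfold yy at this
    have e : ε • ((1:R) + ε • π (swap u v)) = 0 := by rw [this, smul_zero]
    rw [smul_add, smul_smul, hε, one_smul] at e
    rw [mul_one, neg_smul]
    exact eq_neg_of_add_eq_zero_right e
  exact one_ne_zero h2

/-- the eigen-pieces -/
def pe (π : Perm α → R) (ε : ℂ) (x y : α) : Perm (Sub2 x y) → R :=
  fun h => π (Perm.ofSubtype h) * ((1/2 : ℂ) • yy π ε x y)

lemma ofSubtype_commute {π : Perm α → R} (hm : Mult π) (h1 : π 1 = 1) (ε : ℂ) (x y : α) (h : Perm (Sub2 x y)) :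
    yy π ε x y * π (Perm.ofSubtype h) = π (Perm.ofSubtype h) * yy π ε x y := by
  have := conj_yy hm h1 ε (Perm.ofSubtype h) x y
  rw [Perm.ofSubtype_apply_of_not_mem h (by simp), Perm.ofSubtype_apply_of_not_mem h (by simp)] at this
  conv_lhs => rw [← this, mul_assoc, ← hm, inv_mul_cancel, h1, mul_one]

lemma pe_mult {π : Perm α → R} (hm : Mult π) (h1 : π 1 = 1) {ε : ℂ} (hε : ε * ε = 1) (x y : α) : Mult (pe π ε x y) := by
  intro g h
  unfold pe
  rw [map_mul, hm]
  simp only [mul_smul_comm, smul_mul_assoc, smul_smul]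
  rw [mul_assoc (π _) (yy π ε x y), ← mul_assoc (yy π ε x y), ofSubtype_commute hm h1, mul_assoc _ (yy π ε x y), yy_sq hm h1 hε]
  simp only [mul_smul_comm, smul_smul, mul_assoc]
  norm_num

lemma pe_swap (π : Perm α → R) (ε : ℂ) (x y : α) (a b : Sub2 x y) :
    pe π ε x y (swap a b) = π (swap a b) * ((1/2 : ℂ) • yy π ε x y) := by
  rw [pe, Perm.ofSubtype_swap_eq]

lemma exists_perm5 {x y a b c x' y' a' b' c' : α} (h1 : [x, y, a, b, c].Nodup) (h2 : [x', y', a', b', c'].Nodup) :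
    ∃ g : Perm α, g x = x' ∧ g y = y' ∧ g a = a' ∧ g b = b' ∧ g c = c' := by
  obtain ⟨g, hg⟩ := exists_perm [x, y, a, b, c].get [x', y', a', b', c'].get (List.nodup_iff_injective_get.1 h1)
    (List.nodup_iff_injective_get.1 h2)
  exact ⟨g, hg 0, hg 1, hg 2, hg 3, hg 4⟩

lemma pe_NL2 [Nontrivial R] {π : Perm α → R} (h : Irr π) (hN : ¬ NR π) (hc : 5 ≤ Fintype.card α) {ε : ℂ} (hε : ε * ε = 1)
    (x y : α) (hxy : x ≠ y) : NL2 (pe π ε x y) := by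
  rintro ⟨a, ha⟩ ⟨b, hb⟩ ⟨c, hc'⟩ hab hac hbc he
  have hab' : a ≠ b := fun h => hab (Subtype.ext h)
  have hac' : a ≠ c := fun h => hac (Subtype.ext h)
  have hbc' : b ≠ c := fun h => hbc (Subtype.ext h)
  rw [pe_swap, pe_swap] at he
  simp only [mul_smul_comm] at he
  have he' : π (swap a b) * yy π ε x y = π (swap a c) * yy π ε x y :=
    smul_right_injective R (show (1/2:ℂ) ≠ 0 by norm_num) he
  have H0 : yy π ε a b * yy π ε x y = yy π ε a c * yy π ε x y := by
    conv_lhs => arg 1; unfold yy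
    conv_rhs => arg 1; unfold yy
    rw [add_mul, add_mul, smul_mul_assoc, smul_mul_assoc, he']
  have H : ∀ x y a b c : α, [x, y, a, b, c].Nodup → yy π ε a b * yy π ε x y = yy π ε a c * yy π ε x y := by
    intro x' y' a' b' c' hnd
    obtain ⟨g, rfl, rfl, rfl, rfl, rfl⟩ := exists_perm5 (x := x) (y := y) (a := a) (b := b) (c := c)
      (by simp [hxy, ha.1.symm, ha.2.symm, hb.1.symm, hb.2.symm, hc'.1.symm, hc'.2.symm, hab', hac', hbc']) hnd
    have key : ∀ u v, yy π ε (g u) (g v) * yy π ε (g x) (g y) = π g * (yy π ε u v * yy π ε x y) * π g⁻¹ := by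
      intro u v
      rw [← conj_yy h.mult h.one, ← conj_yy h.mult h.one]
      calc _ = π g * yy π ε u v * (π g⁻¹ * π g) * yy π ε x y * π g⁻¹ := by simp only [mul_assoc]
        _ = _ := by rw [← h.mult, inv_mul_cancel, h.one, mul_one]; simp only [mul_assoc]
    rw [key, key, H0]
  have H2 : ∀ x y, x ≠ y → ∀ a b c d : α, a ≠ x → a ≠ y → b ≠ x → b ≠ y → c ≠ x → c ≠ y → d ≠ x → d ≠ y → a ≠ b → c ≠ d →
      yy π ε a b * yy π ε x y = yy π ε c d * yy π ε x y := by
    intro x y hxy a b c d h1 h2 h3 h4 h5 h6 h7 h8 h9 h10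
    refine all_eq (β := Sub2 x y) (fun a b => yy π ε a b * yy π ε x y) (fun a b => by rw [yy_comm]) ?_ ⟨a, h1, h2⟩ ⟨b, h3, h4⟩ ⟨c, h5, h6⟩ ⟨d, h7, h8⟩
      (fun h => h9 (congrArg Subtype.val h)) (fun h => h10 (congrArg Subtype.val h))
    rintro ⟨a, ha⟩ ⟨b, hb⟩ ⟨c, hc⟩ hab hac hbc
    apply H
    have hab' : a ≠ b := fun h => hab (Subtype.ext h)
    have hac' : a ≠ c := fun h => hac (Subtype.ext h)
    have hbc' : b ≠ c := fun h => hbc (Subtype.ext h)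
    simp [hxy, ha.1.symm, ha.2.symm, hb.1.symm, hb.2.symm, hc.1.symm, hc.2.symm, hab', hac', hbc']
  set f := yy π ε a b * yy π ε x y with hf
  have pullout : ∀ p q : α, ∀ z : R, π (swap p q) * (yy π ε p q * z) = ε • (yy π ε p q * z) := by
    intro p q z
    rw [← mul_assoc, swap_yy h.mult h.one hε, smul_mul_assoc]
  have mixed : ∀ q, q ≠ x → q ≠ y → ∃ c d : α, f = yy π ε x q * yy π ε c d ∧ f = yy π ε y q * yy π ε c d := by
    intro q hqx hqy
    obtain ⟨⟨c, hcx, hcy⟩, hcq, -⟩ := exists_third (by rw [card_sub2 hxy]; omega) (⟨q, hqx, hqy⟩ : Sub2 x y) ⟨q, hqx, hqy⟩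
    obtain ⟨⟨d, hdx, hdy⟩, hdq, hdc⟩ := exists_third (by rw [card_sub2 hxy]; omega) (⟨q, hqx, hqy⟩ : Sub2 x y) ⟨c, hcx, hcy⟩
    have hcq' : c ≠ q := fun h => hcq (Subtype.ext h)
    have hdq' : d ≠ q := fun h => hdq (Subtype.ext h)
    have hdc' : d ≠ c := fun h => hdc (Subtype.ext h)
    refine ⟨c, d, ?_, ?_⟩
    · rw [hf, H2 x y hxy a b c d ha.1 ha.2 hb.1 hb.2 hcx hcy hdx hdy hab' hdc'.symm,
        yy_commute h.mult ε ε hcx hcy hdx hdy]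
      exact H2 c d hdc'.symm x y x q hcx.symm hdx.symm hcy.symm hdy.symm hcx.symm hdx.symm hcq'.symm hdq'.symm hxy hqx.symm
    · rw [hf, H2 x y hxy a b c d ha.1 ha.2 hb.1 hb.2 hcx hcy hdx hdy hab' hdc'.symm,
        yy_commute h.mult ε ε hcx hcy hdx hdy]
      exact H2 c d hdc'.symm x y y q hcx.symm hdx.symm hcy.symm hdy.symm hcy.symm hdy.symm hcq'.symm hdq'.symm hxy hqy.symm
  have hz : f = 0 := by
    apply h.lin_swap ε
    have main : ∀ p q : α, p ≠ q → (q ≠ x ∧ q ≠ y) → π (swap p q) * f = ε • f := by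
      rintro p q hpq ⟨hqx, hqy⟩
      by_cases hpx : p = x
      · subst hpx
        obtain ⟨c, d, h1, -⟩ := mixed q hqx hqy
        rw [h1, pullout]
      by_cases hpy : p = y
      · subst hpy
        obtain ⟨c, d, -, h1⟩ := mixed q hqx hqy
        rw [h1, pullout]
      rw [hf, H2 x y hxy a b p q ha.1 ha.2 hb.1 hb.2 hpx hpy hqx hqy hab' hpq, pullout]
    intro p q hpq
    by_cases hq : q ≠ x ∧ q ≠ y
    · exact main p q hpq hq
    by_cases hp : p ≠ x ∧ p ≠ y
    · rw [swap_comm]; exact main q p hpq.symm hp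
    have : swap p q = swap x y := by
      by_cases hqx : q = x
      · subst hqx
        have : p = y := by
          by_contra hpy
          exact hp ⟨hpq, hpy⟩
        rw [this, swap_comm]
      · have hqy : q = y := by by_contra hqy; exact hq ⟨hqx, hqy⟩
        subst hqy
        have : p = x := by
          by_contra hpx
          exact hp ⟨hpx, hpq⟩
        rw [this]
    rw [this, hf, yy_commute h.mult ε ε ha.1 ha.2 hb.1 hb.2, pullout]
  exact R0 h hN hc hε hab' ha.1 ha.2 hb.1 hb.2 hxy hz

/-- R2 -/
lemma pe_NR_or [Nontrivial R] {π : Perm α → R} (h : Irr π) (hc : 5 ≤ Fintype.card α) {ε : ℂ} (hε : ε * ε = 1)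
    (x y : α) (hxy : x ≠ y) : NR (pe π ε x y) ∨ NR (pe π (-ε) x y) := by
  by_contra hcon
  push Not at hcon
  have hε' : (-ε) * (-ε) = 1 := by rw [neg_mul_neg, hε]
  have h1 := not_NR (pe_mult h.mult h.one hε x y) hcon.1
  have h2 := not_NR (pe_mult h.mult h.one hε' x y) hcon.2
  have hr := res_NR h.mult (h.NL2 (by omega)) hc x y hxy
  obtain ⟨a, b, hab⟩ := Fintype.exists_pair_of_one_lt_card (α := Sub2 x y) (by rw [card_sub2 hxy]; omega)
  apply hr a b hab
  have key : ∀ a, X (res x y π) a = X (pe π ε x y) a + X (pe π (-ε) x y) a := by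
    intro a
    unfold X
    rw [← Finset.sum_add_distrib]
    refine Finset.sum_congr rfl fun c _ => ?_
    unfold pe res yy
    rw [← mul_add, ← smul_add]
    have : (1 + ε • π (swap x y) + (1 + -ε • π (swap x y))) = (2:ℂ) • (1:R) := by module
    rw [this, smul_smul]; norm_num
  rw [key, key, h1 a b, h2 a b]


end

section
variable {α : Type u} [Fintype α] [DecidableEq α] {R R' : Type*} [Ring R] [Algebra ℂ R] [Ring R'] [Algebra ℂ R']

lemma sum_off {M : Type*} [AddCommGroup M] (f g : α → M) (i : α) (h : ∀ j, j ≠ i → f j = g j) :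
    ∑ j, f j - f i = ∑ j, g j - g i := by
  have : ∑ j, (f j - g j) = f i - g i := by
    apply Finset.sum_eq_single i
    · intro j _ hj; rw [h j hj, sub_self]
    · simp
  rw [Finset.sum_sub_distrib] at this
  rw [sub_eq_sub_iff_sub_eq_sub, this]

lemma triple_swap {π : Perm α → R} (hm : Mult π) {i j m : α} (hji : j ≠ i) (hjm : j ≠ m) (him : i ≠ m) :
    π (swap i j) * π (swap j m) = π (swap i m) * π (swap i j) := by
  rw [← hm, ← hm]
  congr 1
  have := Equiv.swap_mul_swap_mul_swap (x := i) (y := j) (z := m)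
  ext k
  simp only [Perm.mul_apply]
  by_cases h1 : k = i
  · subst h1; rw [swap_apply_of_ne_of_ne hji.symm him, swap_apply_left, swap_apply_of_ne_of_ne hji hjm]
  by_cases h2 : k = j
  · subst h2; rw [swap_apply_left, swap_apply_right, swap_apply_left, swap_apply_of_ne_of_ne him.symm hjm.symm]
  by_cases h3 : k = m
  · subst h3; rw [swap_apply_right, swap_apply_right, swap_apply_of_ne_of_ne h1 h2, swap_apply_right]
  rw [swap_apply_of_ne_of_ne h2 h3, swap_apply_of_ne_of_ne h1 h2, swap_apply_of_ne_of_ne h1 h3]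

lemma R3b {π : Perm α → R} (hm : Mult π) (h1 : π 1 = 1) (x : ℂ) (hX : ∀ a, X π a = x • (1:R))
    (hc : 5 ≤ Fintype.card α) :
    ∃ s : ℂ, (s = 1 ∨ s = -1) ∧ ∀ N : α → α → R, (∀ k, ∑ i, N k i = 0) → (∀ i, ∑ k, N k i = 0) →
      (∀ k l i j, k ≠ l → i ≠ j → (N k i + N l i + N k j + N l j) * π (swap k l) =
        π (swap i j) * (N k i + N l i + N k j + N l j)) →
      ∀ k i j, i ≠ j → π (swap i j) * (N k i + N k j) = s • (N k i + N k j) := by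
  obtain ⟨n, hn⟩ : ∃ n : ℂ, n = (Fintype.card α : ℂ) := ⟨_, rfl⟩
  have hn2 : n - 2 ≠ 0 := by
    rw [hn]
    have : (Fintype.card α : ℂ) ≠ ((2:ℕ) : ℂ) := by
      rw [Ne, Nat.cast_inj]; omega
    intro h; apply this; push_cast; linear_combination h
  have hn14 : (n - 1) * (n - 4) ≠ 0 := by
    rw [hn]
    have h4 : (Fintype.card α : ℂ) ≠ ((4:ℕ) : ℂ) := by
      rw [Ne, Nat.cast_inj]; omega
    have h5 : (Fintype.card α : ℂ) ≠ ((1:ℕ) : ℂ) := by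
      rw [Ne, Nat.cast_inj]; omega
    push_cast at h4 h5
    exact mul_ne_zero (sub_ne_zero.2 h5) (sub_ne_zero.2 h4)
  have hX' : ∀ a, ∑ b, π (swap a b) = x • (1:R) := hX
  have hself : ∀ a, π (swap a a) = 1 := fun a => by rw [swap_self, ← Perm.one_def, h1]
  have hsq : ∀ a b, π (swap a b) * π (swap a b) = 1 := fun a b => by rw [swap_sq hm, h1]
  set lam : ℂ := ((n-2)^2 - (x-2)^2 - (n-x)) / (3*x-3) with hlam
  set mu : ℂ := x - 2 + lam with hmu
  refine ⟨if mu = n - 2 then 1 else -1, by split_ifs <;> simp, ?_⟩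
  intro N hr hcol hE
  set Z : α → α → R := fun k i => ∑ l, N l i * π (swap k l) with hZ
  set L : α → α → R := fun k i => ∑ j, π (swap i j) * N k j with hL
  set Y : α → α → R := fun k i => (x - 2) • N k i + Z k i with hY
  have hF : ∀ k i j, i ≠ j → (n - 2) • (π (swap i j) * (N k i + N k j)) = Y k i + Y k j := by
    intro k i j hij
    have e := sum_off (fun l => (N k i + N l i + N k j + N l j) * π (swap k l))
      (fun l => π (swap i j) * (N k i + N l i + N k j + N l j)) k (fun l hl => hE k l i j hl.symm hij)
    have e1 : ∑ l, (N k i + N l i + N k j + N l j) * π (swap k l) = x • (N k i + N k j) + Z k i + Z k j := by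
      simp only [hZ, add_mul, Finset.sum_add_distrib, ← Finset.mul_sum, hX', mul_smul_comm, mul_one, smul_add]
      abel
    have e2 : ∑ l, π (swap i j) * (N k i + N l i + N k j + N l j) = n • (π (swap i j) * (N k i + N k j)) := by
      rw [← Finset.mul_sum]
      simp only [Finset.sum_add_distrib, hcol, add_zero, Finset.sum_const, Finset.card_univ]
      rw [← smul_add, ← Nat.cast_smul_eq_nsmul ℂ, ← hn, mul_smul_comm]
    simp only [e1, e2, hself, mul_one] at e
    have e3 : π (swap i j) * (N k i + N k i + N k j + N k j) = (2:ℂ) • (π (swap i j) * (N k i + N k j)) := by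
      rw [← mul_smul_comm]; congr 1; module
    rw [e3] at e
    rw [sub_smul, ← e]
    simp only [hY]
    module
  have hZ0 : ∀ k, ∑ j, Z k j = 0 := by
    intro k
    simp only [hZ]
    rw [Finset.sum_comm]
    simp only [← Finset.sum_mul, hr, zero_mul, Finset.sum_const_zero]
  have hY0 : ∀ k, ∑ j, Y k j = 0 := by
    intro k
    simp only [hY, Finset.sum_add_distrib, ← Finset.smul_sum, hr, hZ0, smul_zero, add_zero]
  have hY1 : ∀ k i, Y k i = (x - 2) • N k i + L k i := by
    intro k i
    have e := sum_off (fun j => (n - 2) • (π (swap i j) * (N k i + N k j))) (fun j => Y k i + Y k j) i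
      (fun j hj => hF k i j hj.symm)
    have e1 : ∑ j, (n - 2) • (π (swap i j) * (N k i + N k j)) = (n - 2) • (x • N k i + L k i) := by
      simp only [hL, mul_add, ← Finset.smul_sum, Finset.sum_add_distrib, ← Finset.sum_mul, hX', smul_mul_assoc, one_mul]
    have e2 : ∑ j, (Y k i + Y k j) = n • Y k i := by
      rw [Finset.sum_add_distrib, hY0, add_zero, Finset.sum_const, Finset.card_univ, ← Nat.cast_smul_eq_nsmul ℂ, ← hn]
    simp only [e1, e2, hself, one_mul] at e
    apply smul_right_injective R hn2
    change (n-2) • _ = (n-2) • _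
    calc (n - 2) • Y k i = n • Y k i - (Y k i + Y k i) := by module
      _ = _ := by rw [← e]; module
  have hYL : ∀ k i, ((n - 2)^2) • N k i = (x - 2) • Y k i + ∑ j, π (swap i j) * Y k j := by
    intro k i
    have e := sum_off (fun j => (n - 2) • (N k i + N k j)) (fun j => π (swap i j) * (Y k i + Y k j)) i
      (fun j hj => by
        change (n - 2) • (N k i + N k j) = π (swap i j) * (Y k i + Y k j)
        rw [← hF k i j hj.symm, mul_smul_comm, ← mul_assoc, hsq, one_mul])
    have e1 : ∑ j, (n - 2) • (N k i + N k j) = (n - 2) • (n • N k i) := by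
      rw [← Finset.smul_sum, Finset.sum_add_distrib, hr, add_zero, Finset.sum_const, Finset.card_univ, ← Nat.cast_smul_eq_nsmul ℂ, ← hn]
    have e2 : ∑ j, π (swap i j) * (Y k i + Y k j) = x • Y k i + ∑ j, π (swap i j) * Y k j := by
      simp only [mul_add, Finset.sum_add_distrib, ← Finset.sum_mul, hX', smul_mul_assoc, one_mul]
    simp only [e1, e2, hself, one_mul] at e
    calc ((n - 2)^2) • N k i = (n - 2) • n • N k i - (n - 2) • (N k i + N k i) := by module
      _ = _ := by rw [e]; module
  have hLL : ∀ k i, ∑ j, π (swap i j) * L k j = (1 + x) • L k i + (n - x) • N k i := by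
    intro k i
    have f1 : ∀ m, m ≠ i → (∑ j, π (swap i j) * π (swap j m)) * N k m = ((1 + x) • π (swap i m) - 1) * N k m := by
      intro m hmi
      congr 1
      have e := sum_off (fun j => π (swap i j) * π (swap j m)) (fun j => π (swap i m) * π (swap i j) + if j = i then 0 else 0) m ?_
      · simp only [ite_self, add_zero, hself, hsq, mul_one, ← Finset.mul_sum, hX', mul_smul_comm] at e
        rw [sub_eq_iff_eq_add] at e
        rw [e]; module
      · intro j hjm
        by_cases hji : j = i
        · subst hji; simp only [hself, one_mul, mul_one, ite_self, add_zero]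
        · simp [triple_swap hm hji hjm hmi.symm]
    have e0 : ∑ j, π (swap i j) * L k j = ∑ m, (∑ j, π (swap i j) * π (swap j m)) * N k m := by
      simp only [hL, Finset.mul_sum, Finset.sum_mul]
      rw [Finset.sum_comm]
      simp only [mul_assoc]
    have e := sum_off _ _ i f1
    rw [← e0] at e
    have e1 : ∑ m, ((1 + x) • π (swap i m) - 1) * N k m = (1 + x) • L k i := by
      simp only [hL, sub_mul, one_mul, Finset.sum_sub_distrib, hr, sub_zero, smul_mul_assoc, ← Finset.smul_sum]
    have e2 : ∑ j, π (swap i j) * π (swap j i) = n • (1:R) := by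
      have : ∀ j, π (swap i j) * π (swap j i) = 1 := fun j => by rw [swap_comm j i, hsq]
      simp only [this]
      rw [Finset.sum_const, Finset.card_univ, ← Nat.cast_smul_eq_nsmul ℂ, ← hn]
    rw [e1, e2, hself, sub_eq_iff_eq_add] at e
    rw [e]
    simp only [smul_mul_assoc, sub_mul, one_mul]
    module
  have hfin : ∀ k i, (3*x-3) • L k i = ((n-2)^2 - (x-2)^2 - (n-x)) • N k i := by
    intro k i
    have e := hYL k i
    simp only [hY1, mul_add, Finset.sum_add_distrib, hLL, mul_smul_comm, ← Finset.smul_sum] at e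
    have e' : ∑ j, π (swap i j) * N k j = L k i := rfl
    rw [e'] at e
    rw [sub_smul ((n-2)^2 - (x-2)^2), sub_smul ((n-2)^2), e]; module
  by_cases hx : x = 1
  · have hN0 : ∀ k i, N k i = 0 := by
      intro k i
      have := hfin k i
      subst hx
      have e1 : (3 * (1:ℂ) - 3) = 0 := by norm_num
      have e2 : ((n-2)^2 - ((1:ℂ)-2)^2 - (n-1)) = (n-1)*(n-4) := by ring
      rw [e1, e2, zero_smul] at this
      exact (smul_eq_zero.1 this.symm).resolve_left hn14
    intro k i j hij
    simp [hN0]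
  have hx3 : 3*x-3 ≠ 0 := by
    intro h; apply hx; linear_combination h/3
  have hLl : ∀ k i, L k i = lam • N k i := by
    intro k i
    apply smul_right_injective R hx3
    change (3*x-3) • _ = (3*x-3) • _
    rw [hfin, smul_smul, hlam, mul_div_cancel₀ _ hx3]
  have hYmu : ∀ k i, Y k i = mu • N k i := by
    intro k i
    rw [hY1, hLl, ← add_smul]
  intro k i j hij
  by_cases hall : ∃ k i, N k i ≠ 0
  · obtain ⟨k0, i0, hne⟩ := hall
    have e := hYL k0 i0
    simp only [hYmu, mul_smul_comm, ← Finset.smul_sum] at e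
    have e' : ∑ j, π (swap i0 j) * N k0 j = L k0 i0 := rfl
    rw [e', hLl, smul_smul, smul_smul, ← add_smul, ← sub_eq_zero, ← sub_smul] at e
    have e2 := (smul_eq_zero.1 e).resolve_right hne
    have e3 : (n - 2 - mu) * (n - 2 + mu) = 0 := by
      rw [hmu]; rw [hmu] at e2; linear_combination e2
    have hs : mu = (n - 2) * (if mu = n - 2 then 1 else -1) := by
      split_ifs with h
      · rw [mul_one]; exact h
      · rcases mul_eq_zero.1 e3 with q | q
        · exact absurd (by linear_combination -q) h
        · linear_combination q
    apply smul_right_injective R hn2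
    change (n-2) • _ = (n-2) • _
    rw [hF k i j hij, hYmu, hYmu, ← smul_add, smul_smul, ← hs]
  · push Not at hall
    simp [hall]

lemma sum_ite_T {M : Type*} [AddCommGroup M] [Module ℂ M] (c : Perm α → ℂ) (k l : α) (v : α → α → M) :
    ∑ i, ∑ j, (∑ g : Perm α, if g k = i ∧ g l = j then c g else 0) • v i j = ∑ g : Perm α, c g • v (g k) (g l) := by
  simp only [Finset.sum_smul]
  have : ∀ i, ∑ j, ∑ g : Perm α, (if g k = i ∧ g l = j then c g else 0) • v i j = 
      ∑ g : Perm α, ∑ j, (if g k = i ∧ g l = j then c g else 0) • v i j := fun i => Finset.sum_comm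
  simp only [this]
  rw [Finset.sum_comm]
  refine Finset.sum_congr rfl fun g _ => ?_
  rw [Finset.sum_eq_single (g k) _ (by simp), Finset.sum_eq_single (g l) _ (by simp)]
  · simp
  · intro j _ hj; rw [if_neg (fun h => hj h.2.symm), zero_smul]
  · intro i _ hi
    apply Finset.sum_eq_zero
    intro j _
    rw [if_neg (fun h => hi h.1.symm), zero_smul]

lemma R3 [FiniteDimensional ℂ R] {π : Perm α → R} (hm : Mult π) (h1 : π 1 = 1) (x : ℂ) (hX : ∀ a, X π a = x • (1:R))
    (hc : 5 ≤ Fintype.card α) (hN2 : NL2 π) :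
    ∃ s : ℂ, (s = 1 ∨ s = -1) ∧ ∀ p q : α, p ≠ q → ∀ lf : R →ₗ[ℂ] ℂ,
      (fun g : Perm α => if (g p = p ∧ g q = q) ∨ (g p = q ∧ g q = p) then lf (π g * (1 - s • π (swap p q))) else 0)
        ∈ coef π ^ 3 := by
  obtain ⟨s, hs, hsN⟩ := R3b hm h1 x hX hc
  refine ⟨s, hs, ?_⟩
  have hss : s * s = 1 := by rcases hs with rfl | rfl <;> norm_num
  intro p q hpq lf
  apply mem_of_ann
  intro a ha
  obtain ⟨T, hT⟩ : ∃ T : α → α → α → α → R, ∀ k l i j, T k l i j = ∑ g : Perm α, (if g k = i ∧ g l = j then a g else 0) • π g :=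
    ⟨_, fun _ _ _ _ => rfl⟩
  obtain ⟨N, hN⟩ : ∃ N : α → α → R, ∀ k i, N k i = ∑ g : Perm α, (if g k = i then a g else 0) • π g :=
    ⟨_, fun _ _ => rfl⟩
  have hA : ∀ (l : R →ₗ[ℂ] ℂ) (A : R), ∑ g, (a g * l (π g)) • (π g * A * π g⁻¹) = 0 := by
    intro l A
    apply eq_zero_of_dual
    intro l'
    have hmem : (fun g => l (π g)) * (fun g => l' (π g * A * π g⁻¹)) ∈ coef π ^ 3 := by
      rw [pow_succ' (coef π) 2]
      exact Submodule.mul_mem_mul (coef_mem π l) (conj_mem hm A l')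
    have := ha _ hmem
    rw [map_sum, ← this]
    refine Finset.sum_congr rfl fun g _ => ?_
    rw [map_smul, smul_eq_mul, Pi.mul_apply]; ring
  have hsum : ∑ g, a g • π g = 0 := by
    apply eq_zero_of_dual
    intro l
    by_cases hR : Subsingleton R
    · rw [Subsingleton.elim (∑ g, a g • π g) 0, map_zero]
    rw [not_subsingleton_iff_nontrivial] at hR
    have := hA l 1
    simp only [mul_one, ← hm _ _, mul_inv_cancel, h1] at this
    rw [← Finset.sum_smul] at this
    have h := (smul_eq_zero.1 this).resolve_right one_ne_zero
    rw [map_sum, ← h]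
    simp
  have hr : ∀ k, ∑ i, N k i = 0 := by
    intro k
    simp only [hN]
    rw [Finset.sum_comm, ← hsum]
    refine Finset.sum_congr rfl fun g _ => ?_
    rw [← Finset.sum_smul, Finset.sum_ite_eq, if_pos (Finset.mem_univ _)]
  have hcol : ∀ i, ∑ k, N k i = 0 := by
    intro i
    simp only [hN]
    rw [Finset.sum_comm, ← hsum]
    refine Finset.sum_congr rfl fun g _ => ?_
    rw [← Finset.sum_smul]
    congr 1
    rw [Finset.sum_eq_single (g⁻¹ i)]
    · simp
    · intro k _ hk
      rw [if_neg]
      rintro rfl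
      simp at hk
    · simp
  have hn2 : (Fintype.card α : ℂ) - 2 ≠ 0 := by
    have : (Fintype.card α : ℂ) ≠ ((2:ℕ) : ℂ) := by
      rw [Ne, Nat.cast_inj]; omega
    intro h; apply this; push_cast; linear_combination h
  have hTj : ∀ k l i, ∑ j, T k l i j = N k i := by
    intro k l i
    simp only [hT, hN]
    rw [Finset.sum_comm]
    refine Finset.sum_congr rfl fun g _ => ?_
    rw [← Finset.sum_smul]
    congr 1
    rw [Finset.sum_eq_single (g l) _ (by simp)]
    · simp
    · intro j _ hj; rw [if_neg (fun h => hj h.2.symm)]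
  have hTi : ∀ k l j, ∑ i, T k l i j = N l j := by
    intro k l j
    simp only [hT, hN]
    rw [Finset.sum_comm]
    refine Finset.sum_congr rfl fun g _ => ?_
    rw [← Finset.sum_smul]
    congr 1
    rw [Finset.sum_eq_single (g k) _ (by simp)]
    · simp
    · intro j _ hj; rw [if_neg (fun h => hj h.1.symm)]
  have hS1 : ∀ k l i j, k ≠ l → i ≠ j → ((Fintype.card α : ℂ) - 2) • (T k l i j + T k l j i) = N k i + N l i + N k j + N l j := by
    intro k l i j hkl hij
    rw [← sub_eq_zero]
    apply eq_zero_of_dual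
    intro lf
    have ht : ∀ i j, lf (T k l i j) = ∑ g : Perm α, if g k = i ∧ g l = j then a g * lf (π g) else 0 := by
      intro i j
      rw [hT, map_sum]
      refine Finset.sum_congr rfl fun g _ => ?_
      rw [map_smul, smul_eq_mul]; split_ifs <;> simp
    have key : ∀ (M : Type _) [AddCommGroup M] [Module ℂ M] (v : α → α → M), 
        ∑ i, ∑ j, lf (T k l i j) • v i j = ∑ g : Perm α, (a g * lf (π g)) • v (g k) (g l) := by
      intro M _ _ v
      simp only [ht]
      exact sum_ite_T _ k l v
    have key2 : ∀ (M : Type _) [AddCommGroup M] [Module ℂ M] (v : α → α → M), (∀ i j, v i j = v j i) →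
        ∑ i, ∑ j, lf (T k l j i) • v i j = ∑ g : Perm α, (a g * lf (π g)) • v (g k) (g l) := by
      intro M _ _ v hv
      rw [Finset.sum_comm, ← key M v]
      simp only [hv]
    have e1 : ∑ g : Perm α, (a g * lf (π g)) • π (swap (g k) (g l)) = 0 := by
      rw [← hA lf (π (swap k l))]
      simp only [pi_conj_swap hm]
    have e2 : ∑ g : Perm α, a g * lf (π g) = 0 := by
      have := congrArg lf hsum
      rw [map_sum, map_zero] at this
      simpa using this
    have := s_solve hm (fun i j => lf (T k l i j + T k l j i)) (fun i j => by rw [add_comm]) (fun i => by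
        have : T k l i i = 0 := by
          rw [hT]
          apply Finset.sum_eq_zero
          intro g _
          rw [if_neg, zero_smul]
          rintro ⟨h, h'⟩
          exact hkl (g.injective (h.trans h'.symm))
        change lf (T k l i i + T k l i i) = 0
        rw [this]; simp) (by
        simp only [map_add, add_smul, Finset.sum_add_distrib]
        rw [key, key2 _ _ (fun i j => by rw [swap_comm]), e1, add_zero]) hN2 (by
        simp only [map_add, Finset.sum_add_distrib]
        simp only [← map_sum, hTj, hTi, hr, map_zero, add_zero]) (by omega) i j hij
    simp only [← map_sum, Finset.sum_add_distrib, hTj, hTi] at this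
    rw [map_sub, map_smul, smul_eq_mul, this]
    simp only [map_add]; ring
  have hS2 : ∀ k l i j, (T k l i j + T k l j i) * π (swap k l) = π (swap i j) * (T k l i j + T k l j i) := by
    intro k l i j
    have aux : ∀ i j, T k l i j * π (swap k l) = π (swap i j) * T k l i j := by
      intro i j
      rw [hT, Finset.sum_mul, Finset.mul_sum]
      refine Finset.sum_congr rfl fun g _ => ?_
      split_ifs with h
      · rw [smul_mul_assoc, mul_smul_comm, ← h.1, ← h.2, ← pi_conj_swap hm, mul_assoc, ← hm g⁻¹ g, inv_mul_cancel, h1, mul_one]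
      · simp
    rw [add_mul, mul_add, aux, aux, swap_comm j i]
  have hE : ∀ k l i j, k ≠ l → i ≠ j → (N k i + N l i + N k j + N l j) * π (swap k l) =
        π (swap i j) * (N k i + N l i + N k j + N l j) := by
    intro k l i j hkl hij
    rw [← hS1 k l i j hkl hij, smul_mul_assoc, mul_smul_comm, hS2]
  have hfin := hsN N hr hcol hE
  have hS3 : (T p q p q + T p q q p) * (1 - s • π (swap p q)) = 0 := by
    rw [mul_sub, mul_smul_comm, hS2, mul_one]
    apply smul_right_injective R hn2
    change ((Fintype.card α : ℂ) - 2) • _ = ((Fintype.card α : ℂ) - 2) • _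
    rw [smul_zero, smul_sub, smul_comm, ← mul_smul_comm, hS1 p q p q hpq hpq]
    have e : N p p + N q p + N p q + N q q = (N p p + N p q) + (N q p + N q q) := by abel
    rw [e, mul_add, hfin p p q hpq, hfin q p q hpq, ← smul_add, smul_smul, hss, one_smul, sub_self]
  have e4 : ∑ g, a g * (if (g p = p ∧ g q = q) ∨ (g p = q ∧ g q = p) then lf (π g * (1 - s • π (swap p q))) else 0)
      = lf ((T p q p q + T p q q p) * (1 - s • π (swap p q))) := by
    rw [hT, hT, ← Finset.sum_add_distrib, Finset.sum_mul, map_sum]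
    refine Finset.sum_congr rfl fun g _ => ?_
    rw [← add_smul, smul_mul_assoc, map_smul, smul_eq_mul]
    by_cases c1 : g p = p ∧ g q = q
    · have c2 : ¬ (g p = q ∧ g q = p) := fun h => hpq (c1.1.symm.trans h.1)
      rw [if_pos (Or.inl c1), if_pos c1, if_neg c2, add_zero]
    · by_cases c2 : g p = q ∧ g q = p
      · rw [if_pos (Or.inr c2), if_neg c1, if_pos c2, zero_add]
      · rw [if_neg (not_or.2 ⟨c1, c2⟩), if_neg c1, if_neg c2]; simp
  rw [e4, hS3, map_zero]


end

section
variable {α : Type u} [Fintype α] [DecidableEq α] {R R' : Type*} [Ring R] [Algebra ℂ R] [Ring R'] [Algebra ℂ R']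

def ce (π : Perm α → R) (ε : ℂ) (x y : α) : Submodule ℂ (Perm α → ℂ) :=
  coef (fun g => π g * ((1/2 : ℂ) • yy π ε x y))

lemma ce_le (π : Perm α → R) (ε : ℂ) (x y : α) : ce π ε x y ≤ coef π := by
  rintro f ⟨l, hl⟩
  have : f = fun g => (l ∘ₗ LinearMap.mulRight ℂ ((1/2 : ℂ) • yy π ε x y)) (π g) := by
    ext g; rw [hl]; rfl
  rw [this]
  exact coef_mem _ _

def Ee (τ : Perm α) (δ : ℂ) : Submodule ℂ (Perm α → ℂ) where
  carrier := {f | ∀ g, f (g * τ) = δ * f g}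
  add_mem' := by
    intro f f' h h' g
    simp only [Pi.add_apply]
    rw [h, h']; ring
  zero_mem' := by intro g; simp
  smul_mem' := by
    intro c f h g
    simp only [Pi.smul_apply, smul_eq_mul]
    rw [h]; ring

lemma Ee_mul (τ : Perm α) (δ δ' : ℂ) : Ee τ δ * Ee τ δ' ≤ Ee τ (δ * δ') := by
  rw [Submodule.mul_le]
  intro f hf f' hf' g
  simp only [Pi.mul_apply]
  rw [hf g, hf' g]; ring

lemma Ee_pow (τ : Perm α) (δ : ℂ) (p : ℕ) : (Ee τ δ) ^ p ≤ Ee τ (δ ^ p) := by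
  induction p with
  | zero =>
    rw [pow_zero, pow_zero, Submodule.one_le]
    intro g; simp
  | succ p ih =>
    rw [pow_succ, pow_succ]
    exact (mul_le_mul' ih le_rfl).trans (Ee_mul _ _ _)

lemma ce_le_Ee {π : Perm α → R} (h : Mult π) (h1 : π 1 = 1) {ε : ℂ} (hε : ε * ε = 1) (x y : α) :
    ce π ε x y ≤ Ee (swap x y) ε := by
  rintro f ⟨l, hl⟩ g
  rw [hl, hl]
  beta_reduce
  rw [h, mul_assoc, mul_smul_comm, swap_yy h h1 hε, smul_comm, mul_smul_comm, map_smul, smul_eq_mul]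

lemma map_ce (π : Perm α → R) (ε : ℂ) (x y : α) :
    (ce π ε x y).map (pull (Perm.ofSubtype : Perm (Sub2 x y) →* Perm α)).toLinearMap = coef (pe π ε x y) :=
  map_pull_coef _ _

lemma D_mem [FiniteDimensional ℂ R] {π : Perm α → R} (h : Mult π) (h1 : π 1 = 1) {ε : ℂ} (hε : ε * ε = 1) (x y : α)
    (hxy : x ≠ y)
    (h3 : ∀ lf : R →ₗ[ℂ] ℂ,
      (fun g : Perm α => if (g x = x ∧ g y = y) ∨ (g x = y ∧ g y = x) then lf (π g * yy π ε x y) else 0)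
        ∈ coef π ^ 3) (p q : ℕ) (hJ : coef (pe π ε x y) ^ (p+1) * coef (pe π (-ε) x y) ^ q = ⊤) :
    (fun g : Perm α => (if g = 1 then 1 else 0) + (ε^(p+1) * (-ε)^q) * (if g = swap x y then 1 else 0))
      ∈ coef π ^ (p + q + 3) := by
  have hε' : (-ε) * (-ε) = 1 := by rw [neg_mul_neg, hε]
  set ind : Perm α → ℂ := fun g => if (g x = x ∧ g y = y) ∨ (g x = y ∧ g y = x) then 1 else 0 with hind
  have hA : ∀ f ∈ ce π ε x y, ind * f ∈ coef π ^ 3 := by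
    rintro f ⟨l, hl⟩
    have := h3 ((1/2:ℂ) • l)
    convert this using 1
    ext g
    simp only [hind, Pi.mul_apply, hl, mul_smul_comm, map_smul, LinearMap.smul_apply]
    split_ifs <;> simp
  have hB : ∀ f ∈ ce π ε x y ^ (p+1) * ce π (-ε) x y ^ q, ind * f ∈ coef π ^ (p + q + 3) := by
    intro f hf
    rw [pow_succ', mul_assoc] at hf
    refine Submodule.mul_induction_on hf ?_ ?_
    · intro f1 hf1 f2 hf2
      rw [← mul_assoc, add_comm (p+q) 3, pow_add, pow_add]
      refine Submodule.mul_mem_mul (hA _ hf1) ?_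
      exact mul_le_mul' (pow_le_pow_left' (ce_le _ _ _ _) _) (pow_le_pow_left' (ce_le _ _ _ _) _) hf2
    · intro f1 f2 hf1 hf2
      rw [mul_add]
      exact Submodule.add_mem _ hf1 hf2
  have hC : ce π ε x y ^ (p+1) * ce π (-ε) x y ^ q ≤ Ee (swap x y) (ε^(p+1) * (-ε)^q) :=
    (mul_le_mul' ((pow_le_pow_left' (ce_le_Ee h h1 hε x y) _).trans (Ee_pow _ _ _))
      ((pow_le_pow_left' (ce_le_Ee h h1 hε' x y) _).trans (Ee_pow _ _ _))).trans (Ee_mul _ _ _)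
  have hJ' : (ce π ε x y ^ (p+1) * ce π (-ε) x y ^ q).map (pull (Perm.ofSubtype : Perm (Sub2 x y) →* Perm α)).toLinearMap = ⊤ := by
    rw [Submodule.map_mul, Submodule.map_pow, Submodule.map_pow, map_ce, map_ce, hJ]
  have hd : (fun h : Perm (Sub2 x y) => if h = 1 then (1:ℂ) else 0) ∈ 
      (ce π ε x y ^ (p+1) * ce π (-ε) x y ^ q).map (pull (Perm.ofSubtype : Perm (Sub2 x y) →* Perm α)).toLinearMap := by
    rw [hJ']; trivial
  obtain ⟨f, hf, hf2⟩ := hd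
  have hf3 : ∀ h : Perm (Sub2 x y), f (Perm.ofSubtype h) = if h = 1 then (1:ℂ) else 0 := fun h => congrFun hf2 h
  have hf4 : ∀ g : Perm α, g x = x → g y = y → f g = if g = 1 then 1 else 0 := by
    intro g hgx hgy
    obtain ⟨h, rfl⟩ := mem_range_ofSubtype g hgx hgy
    rw [hf3]
    congr 1
    rw [map_eq_one_iff _ Perm.ofSubtype_injective]
  have hf5 := hC hf
  convert hB f hf using 1
  ext g
  simp only [hind, Pi.mul_apply]
  have hne : (1 : Perm α) ≠ swap x y := by
    intro h
    have := congrArg (fun σ : Perm α => σ x) h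
    simp [hxy] at this
  by_cases c1 : g x = x ∧ g y = y
  · rw [if_pos (Or.inl c1), one_mul, hf4 g c1.1 c1.2, if_neg (c := g = swap x y), mul_zero, add_zero]
    rintro rfl
    rw [swap_apply_left] at c1
    exact hxy c1.1.symm
  by_cases c2 : g x = y ∧ g y = x
  · rw [if_pos (Or.inr c2), one_mul]
    have e : f g = (ε^(p+1) * (-ε)^q) * f (g * swap x y) := by
      rw [← hf5 (g * swap x y), mul_assoc, swap_mul_self, mul_one]
    rw [e, hf4 _ (by simp [c2.2]) (by simp [c2.1]), if_neg, zero_add]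
    · congr 2
      rw [mul_eq_one_iff_eq_inv, swap_inv]
    · rintro rfl; exact hxy c2.1
  · rw [if_neg (not_or.2 ⟨c1, c2⟩), zero_mul, if_neg, if_neg]; simp
    · rintro rfl; simp at c2
    · rintro rfl; simp at c1

theorem R4 [Nontrivial R] [FiniteDimensional ℂ R] {π : Perm α → R} (h : Irr π) (hN : ¬ NR π) (hc : 5 ≤ Fintype.card α) :
    coef π ^ (Fintype.card α - 1) = ⊤ ∨
      (Fintype.card α = 6 ∧ ∃ ε : ℂ, ε * ε = 1 ∧ ∃ x y : α, x ≠ y ∧ ¬ NR (pe π ε x y)) := by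
  obtain ⟨z, hz⟩ := h.rect hN
  have hN2 := h.NL2 (by omega)
  obtain ⟨s, hs, hR3⟩ := R3 h.mult h.one z hz hc hN2
  obtain ⟨x, y, hxy⟩ := Fintype.exists_pair_of_one_lt_card (α := α) (by omega)
  obtain ⟨ε, hεs⟩ : ∃ ε, ε = -s := ⟨_, rfl⟩
  have hε : ε * ε = 1 := by rcases hs with rfl | rfl <;> rw [hεs] <;> norm_num
  have hε' : (-ε) * (-ε) = 1 := by rw [neg_mul_neg, hε]
  have h3 : ∀ lf : R →ₗ[ℂ] ℂ,
      (fun g : Perm α => if (g x = x ∧ g y = y) ∨ (g x = y ∧ g y = x) then lf (π g * yy π ε x y) else 0)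
        ∈ coef π ^ 3 := by
    intro lf
    have := hR3 x y hxy lf
    have e : yy π ε x y = 1 - s • π (swap x y) := by unfold yy; rw [hεs]; module
    rw [e]; exact this
  have hD := fun p q => D_mem h.mult h.one hε x y hxy h3 p q
  set A := pe π ε x y with hA
  set B := pe π (-ε) x y with hB
  have mA : Mult A := pe_mult h.mult h.one hε x y
  have mB : Mult B := pe_mult h.mult h.one hε' x y
  have A2 : NL2 A := pe_NL2 h hN hc hε x y hxy
  have B2 : NL2 B := pe_NL2 h hN hc hε' x y hxy
  have cs := card_sub2 hxy
  have A1 : NL1 A := NL2.NL1 mA (by omega) A2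
  have B1 : NL1 B := NL2.NL1 mB (by omega) B2
  have fin : ∀ p q p' q', p + q + 4 = Fintype.card α → p' + q' + 4 = Fintype.card α → 
      coef A ^ (p+1) * coef B ^ q = ⊤ → coef A ^ (p'+1) * coef B ^ q' = ⊤ →
      ε^(p+1) * (-ε)^q = - (ε^(p'+1) * (-ε)^q') → coef π ^ (Fintype.card α - 1) = ⊤ := by
    intro p q p' q' e e' H H' hs
    have m1 := hD p q H
    have m2 := hD p' q' H'
    have e1 : p + q + 3 = Fintype.card α - 1 := by omega
    have e2 : p' + q' + 3 = Fintype.card α - 1 := by omega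
    rw [e1] at m1
    rw [e2] at m2
    apply top_of_delta (((LInv.coef h.mult).pow _))
    convert Submodule.smul_mem _ (1/2:ℂ) (Submodule.add_mem _ m1 m2) using 1
    ext g
    simp only [Pi.smul_apply, Pi.add_apply, smul_eq_mul, hs]
    ring
  by_cases hAN : NR A
  · left
    have P1 := Pm (Fintype.card α - 2) (Sub2 x y) cs (by omega) A A mA mA A1 A2 (fun _ => hAN)
    have P2 := Pm (Fintype.card α - 2) (Sub2 x y) cs (by omega) A B mA mB B1 B2 (fun _ => hAN)
    obtain ⟨r, hr⟩ : ∃ r, Fintype.card α = r + 5 := ⟨_, (Nat.sub_add_cancel hc).symm⟩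
    have er : Fintype.card α - 2 - 2 = r + 1 := by omega
    rw [er] at P1 P2
    refine fin (r+1) 0 r 1 (by omega) (by omega) ?_ ?_ (by ring)
    · rw [pow_zero, mul_one, pow_succ]; exact P1
    · rw [pow_one]; exact P2
  · have hBN : NR B := (pe_NR_or h hc hε x y hxy).resolve_left hAN
    have h5 : Fintype.card α ≠ 5 := fun h5 => hAN (NR_of_NL2_three mA (by omega) A2)
    by_cases h6 : Fintype.card α = 6
    · right; exact ⟨h6, ε, hε, x, y, hxy, hAN⟩
    left
    obtain ⟨r, hr⟩ : ∃ r, Fintype.card α = r + 7 := ⟨Fintype.card α - 7, by omega⟩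
    have P1 := Pm (Fintype.card α - 2) (Sub2 x y) cs (by omega) B A mB mA A1 A2 (fun _ => hBN)
    have er : Fintype.card α - 2 - 2 = r + 3 := by omega
    rw [er] at P1
    refine fin 0 (r+3) 1 (r+2) (by omega) (by omega) ?_ ?_ (by ring)
    · rw [mul_comm, zero_add, pow_one]; exact P1
    · obtain ⟨u, v, huv⟩ := Fintype.exists_pair_of_one_lt_card (α := Sub2 x y) (by omega)
      have cs' := card_sub2 huv
      have P2 := top_step mB hBN (by omega) u v huv (K := coef A ^ 2 * coef B ^ r)
        (((LInv.coef mA).pow _).mul ((LInv.coef mB).pow _)) (by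
          rw [Submodule.map_mul, Submodule.map_pow, Submodule.map_pow, map_pull_coef, map_pull_coef]
          have := Pm2 (Sub2 u v) (by omega) (res u v A) (res u v B) (res_mult mA) (res_mult mB)
            (res_NR mA A2 (by omega) u v huv) (res_NR mB B2 (by omega) u v huv)
          have e : Fintype.card (Sub2 u v) - 3 = r := by omega
          rw [e] at this
          exact this)
      rw [← P2, ← mul_assoc, mul_comm (coef B ^ 2), mul_assoc, ← pow_add, add_comm 2 r]


end

section

/-- edge colourings of the complete graph on six letters (the six synthematic totals), packed in base 8 -/
def tot (i a b : Fin 6) : ℕ :=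
  58266373609688829389850804239727960655935051666464838398289919959829042553492154212723028827520858296801673682941534911359162329836445447311018842124930105578979702755428395621243488397007701640
    / 8 ^ (36 * i.val + 6 * a.val + b.val) % 8

def rr (i a b c d : Fin 6) : Bool := Nat.beq (tot i a b) (tot i c d)

def PP (g h : Perm (Fin 6)) : Prop := ∀ i a b c d, rr (h i) (g a) (g b) (g c) (g d) = rr i a b c d

instance (g h) : Decidable (PP g h) := by unfold PP; infer_instance

def ss (i : Fin 5) : Perm (Fin 6) := swap i.castSucc i.succ
def tt : Fin 5 → Perm (Fin 6) := ![swap 0 1 * swap 2 3 * swap 4 5, swap 0 4 * swap 1 2 * swap 3 5,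
  swap 0 1 * swap 2 5 * swap 3 4, swap 0 4 * swap 1 5 * swap 2 3, swap 0 1 * swap 2 4 * swap 3 5]

set_option maxRecDepth 10000 in
lemma PP_st : ∀ i, PP (ss i) (tt i) := by decide +kernel
set_option maxRecDepth 10000 in
lemma PP_ts : ∀ i, PP (tt i) (ss i) := by decide +kernel
lemma rr_inj : ∀ i j, i ≠ j → ∃ a b c d, rr i a b c d ≠ rr j a b c d := by decide +kernel

lemma PP_mul {g h g' h' : Perm (Fin 6)} (H : PP g h) (H' : PP g' h') : PP (g * g') (h * h') := by
  intro i a b c d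
  simp only [Perm.mul_apply]
  rw [H, H']

lemma PP_one : PP 1 1 := fun _ _ _ _ _ => rfl

lemma PP_unique {g h h' : Perm (Fin 6)} (H : PP g h) (H' : PP g h') : h = h' := by
  ext1 i
  by_contra hne
  obtain ⟨a, b, c, d, hr⟩ := rr_inj _ _ hne
  apply hr
  have e1 := H i (g⁻¹ a) (g⁻¹ b) (g⁻¹ c) (g⁻¹ d)
  have e2 := H' i (g⁻¹ a) (g⁻¹ b) (g⁻¹ c) (g⁻¹ d)
  have hg : ∀ a, g (g⁻¹ a) = a := fun a => by simp
  simp only [hg] at e1 e2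
  rw [e1, e2]

lemma closure_ss : Submonoid.closure (Set.range ss) = ⊤ := Equiv.Perm.mclosure_swap_castSucc_succ 5

lemma PP_exists (g : Perm (Fin 6)) : ∃ h, PP g h := by
  have : g ∈ Submonoid.closure (Set.range ss) := by rw [closure_ss]; trivial
  induction this using Submonoid.closure_induction with
  | mem x hx => obtain ⟨i, rfl⟩ := hx; exact ⟨_, PP_st i⟩
  | one => exact ⟨1, PP_one⟩
  | mul x y _ _ hx hy =>
    obtain ⟨h, hx⟩ := hx
    obtain ⟨h', hy⟩ := hy
    exact ⟨_, PP_mul hx hy⟩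

def outHom : Perm (Fin 6) →* Perm (Fin 6) where
  toFun g := (PP_exists g).choose
  map_one' := PP_unique (PP_exists 1).choose_spec PP_one
  map_mul' g h := PP_unique (PP_exists (g * h)).choose_spec (PP_mul (PP_exists g).choose_spec (PP_exists h).choose_spec)

lemma outHom_eq {g h} (H : PP g h) : outHom g = h := PP_unique (PP_exists g).choose_spec H

lemma outHom_surj : Function.Surjective outHom := by
  rw [← MonoidHom.mrange_eq_top, eq_top_iff, ← closure_ss, Submonoid.closure_le]
  rintro _ ⟨i, rfl⟩
  exact ⟨tt i, outHom_eq (PP_ts i)⟩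

def outEquiv : Perm (Fin 6) ≃* Perm (Fin 6) :=
  MulEquiv.ofBijective outHom ((Fintype.bijective_iff_surjective_and_card _).2 ⟨outHom_surj, rfl⟩)

lemma out0 : outEquiv (swap 0 1) = swap 0 1 * swap 2 3 * swap 4 5 := outHom_eq (PP_st 0)
lemma out4 : outEquiv (swap 4 5) = swap 0 1 * swap 2 4 * swap 3 5 := outHom_eq (PP_st 4)


end

section
variable {R : Type*} [Ring R] [Algebra ℂ R]

lemma sum4 {β M : Type*} [Fintype β] [DecidableEq β] [AddCommMonoid M] (hc : Fintype.card β = 4) {a b c d : β}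
    (hn : [a, b, c, d].Nodup) (f : β → M) : ∑ w, f w = f a + (f b + (f c + f d)) := by
  have : (Finset.univ : Finset β) = [a, b, c, d].toFinset := by
    symm
    apply Finset.eq_univ_of_card
    rw [List.toFinset_card_of_nodup hn, hc]; rfl
  rw [this, List.sum_toFinset _ hn]
  simp

lemma t_comm {α : Type*} [Fintype α] [DecidableEq α] {π : Perm α → R} (h : Mult π) {a b c d : α}
    (hac : a ≠ c) (had : a ≠ d) (hbc : b ≠ c) (hbd : b ≠ d) :
    π (swap a b) * π (swap c d) = π (swap c d) * π (swap a b) := by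
  have h2 := pi_conj_swap h (swap a b) c d
  rw [swap_apply_of_ne_of_ne hac.symm hbc.symm, swap_apply_of_ne_of_ne had.symm hbd.symm] at h2
  conv_rhs => rw [← h2, mul_assoc, ← h (swap a b)⁻¹ (swap a b), inv_mul_cancel, mul_assoc, pi_mul_one h]

lemma six1 {π : Perm (Fin 6) → R} (h : Irr π) {ε : ℂ} (x y : Fin 6) (hxy : x ≠ y) (hε : ε * ε = 1)
    (hN : ¬ NR (pe π ε x y)) (x' y' a' b' c' d' : Fin 6) (hnd' : [x', y', a', b', c', d'].Nodup) :
    (π (swap a' b') - π (swap c' d')) * yy π ε x' y' = 0 := by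
  have cs : Fintype.card (Sub2 x y) = 4 := by rw [card_sub2 hxy]; rfl
  obtain ⟨e⟩ := Fintype.card_eq.1 (cs.trans (Fintype.card_fin 4).symm)
  obtain ⟨a, ha⟩ : ∃ a, a = e.symm 0 := ⟨_, rfl⟩
  obtain ⟨b, hb⟩ : ∃ a, a = e.symm 1 := ⟨_, rfl⟩
  obtain ⟨c, hc⟩ : ∃ a, a = e.symm 2 := ⟨_, rfl⟩
  obtain ⟨d, hd⟩ : ∃ a, a = e.symm 3 := ⟨_, rfl⟩
  have hnd : [a, b, c, d].Nodup := by
    rw [ha, hb, hc, hd]; simp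
  have hX := not_NR (pe_mult h.mult h.one hε x y) hN
  have hself : ∀ a, π (swap a a) = 1 := fun a => by rw [swap_self, ← Perm.one_def, h.one]
  have e1 := congrArg₂ (· + ·) (hX a c) (hX b d)
  simp only [X, sum4 cs hnd, pe_swap, hself] at e1
  have H0 : (π (swap (a : Fin 6) b) - π (swap (c : Fin 6) d)) * yy π ε x y = 0 := by
    rw [swap_comm (b : Fin 6) a, swap_comm (c : Fin 6) a, swap_comm (c : Fin 6) b, swap_comm (d : Fin 6) a, 
      swap_comm (d : Fin 6) b, swap_comm (d : Fin 6) c] at e1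
    rw [← sub_eq_zero] at e1
    simp only [mul_smul_comm] at e1
    rw [← e1, sub_mul]
    module
  have hnd2 : [x, y, a, b, c, d].Nodup := by
    have h1 := a.2
    have h2 := b.2
    have h3 := c.2
    have h4 := d.2
    have : [(a : Fin 6), b, c, d].Nodup := hnd.map Subtype.val_injective
    rw [List.nodup_cons, List.nodup_cons]
    refine ⟨?_, ?_, this⟩
    · simp [hxy, h1.1.symm, h2.1.symm, h3.1.symm, h4.1.symm]
    · simp [hxy, h1.2.symm, h2.2.symm, h3.2.symm, h4.2.symm]
  obtain ⟨g, hg⟩ := exists_perm [x, y, (a : Fin 6), b, c, d].get [x', y', a', b', c', d'].get (List.nodup_iff_injective_get.1 hnd2)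
    (List.nodup_iff_injective_get.1 hnd')
  have g0 : g x = x' := hg 0
  have g1 : g y = y' := hg 1
  have g2 : g a = a' := hg 2
  have g3 : g b = b' := hg 3
  have g4 : g c = c' := hg 4
  have g5 : g d = d' := hg 5
  have e := congrArg (fun M => π g * M * π g⁻¹) H0
  simp only [mul_zero, zero_mul] at e
  rw [← e, ← g0, ← g1, ← g2, ← g3, ← g4, ← g5, ← pi_conj_swap h.mult, ← pi_conj_swap h.mult, ← conj_yy h.mult h.one]
  rw [← sub_mul, ← mul_sub]
  calc _ = π g * (π (swap (a : Fin 6) b) - π (swap (c : Fin 6) d)) * (π g⁻¹ * π g) * yy π ε x y * π g⁻¹ := by simp only [mul_assoc]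
    _ = _ := by rw [← h.mult, inv_mul_cancel, h.one, mul_one]; simp only [mul_assoc]

def YY (π : Perm (Fin 6) → R) (ε : ℂ) (a b c d e f : Fin 6) : R :=
  1 - ε • (π (swap a b) * π (swap c d) * π (swap e f))

lemma six2 {π : Perm (Fin 6) → R} (h : Irr π) {ε : ℂ} (hε : ε * ε = 1)
    (H : ∀ x y a b c d : Fin 6, [x, y, a, b, c, d].Nodup → (π (swap a b) - π (swap c d)) * yy π ε x y = 0)
    (a b c d e f : Fin 6) (hnd : [a, b, c, d, e, f].Nodup) :
    π (swap a b) * YY π ε a b c d e f = (-ε) • YY π ε a b c d e f := by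
  have h0 := H a b c d e f hnd
  have hsq : ∀ a b, π (swap a b) * π (swap a b) = 1 := fun a b => by rw [swap_sq h.mult, h.one]
  simp only [List.nodup_cons, List.mem_cons, not_or, List.not_mem_nil] at hnd
  have c1 : π (swap c d) * π (swap a b) = π (swap a b) * π (swap c d) := 
    t_comm h.mult (by tauto) (by tauto) (by tauto) (by tauto)
  have c2 : π (swap e f) * π (swap a b) = π (swap a b) * π (swap e f) := 
    t_comm h.mult (by tauto) (by tauto) (by tauto) (by tauto)
  have e1 := congrArg (fun M => ε • (π (swap c d) * M)) h0
  simp only [yy, mul_zero, smul_zero, sub_mul, mul_sub, mul_add, mul_one, mul_smul_comm, ← mul_assoc, hsq, one_mul,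
    smul_sub, smul_add, smul_smul, hε, one_smul] at e1
  rw [mul_assoc (π (swap c d)) (π (swap e f)), c2, ← mul_assoc, c1, ← sub_eq_zero, sub_zero] at e1
  unfold YY
  simp only [mul_sub, mul_one, mul_smul_comm, ← mul_assoc, hsq, one_mul, smul_sub, smul_smul, neg_mul, hε]
  rw [← sub_eq_zero, ← e1]
  module

lemma YY_perm1 {π : Perm (Fin 6) → R} (h : Irr π) (ε : ℂ) (a b c d e f : Fin 6) (hnd : [a, b, c, d, e, f].Nodup) :
    YY π ε a b c d e f = YY π ε c d a b e f := by
  unfold YY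
  simp only [List.nodup_cons, List.mem_cons, not_or, List.not_mem_nil] at hnd
  have c1 : π (swap c d) * π (swap a b) = π (swap a b) * π (swap c d) := 
    t_comm h.mult (by tauto) (by tauto) (by tauto) (by tauto)
  rw [c1]

lemma YY_perm2 {π : Perm (Fin 6) → R} (h : Irr π) (ε : ℂ) (a b c d e f : Fin 6) (hnd : [a, b, c, d, e, f].Nodup) :
    YY π ε a b c d e f = YY π ε e f a b c d := by
  unfold YY
  simp only [List.nodup_cons, List.mem_cons, not_or, List.not_mem_nil] at hnd
  have c1 : π (swap e f) * π (swap a b) = π (swap a b) * π (swap e f) := 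
    t_comm h.mult (by tauto) (by tauto) (by tauto) (by tauto)
  have c2 : π (swap e f) * π (swap c d) = π (swap c d) * π (swap e f) := 
    t_comm h.mult (by tauto) (by tauto) (by tauto) (by tauto)
  rw [c1, mul_assoc, mul_assoc, c2]

lemma six3 {π : Perm (Fin 6) → R} (h : Irr π) {ε : ℂ} (hε : ε = 1 ∨ ε = -1) (x : ℂ) (hx : ∀ a, X π a = x • (1 : R)) (f : R)
    (h01 : π (swap 0 1) * f = (-ε) • f) (h23 : π (swap 2 3) * f = (-ε) • f) (h45 : π (swap 4 5) * f = (-ε) • f)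
    (h24 : π (swap 2 4) * f = (-ε) • f) (h35 : π (swap 3 5) * f = (-ε) • f) : f = 0 := by
  have hεε : ε * ε = 1 := by rcases hε with rfl | rfl <;> norm_num
  have hself : ∀ a, π (swap a a) = 1 := fun a => by rw [swap_self, ← Perm.one_def, h.one]
  have hsq : ∀ a b, π (swap a b) * π (swap a b) = 1 := fun a b => by rw [swap_sq h.mult, h.one]
  have tri : ∀ a b c : Fin 6, a ≠ c → b ≠ c → π (swap a b) * f = (-ε) • f → π (swap b c) * f = (-ε) • f → π (swap a c) * f = (-ε) • f := by
    intro a b c hac hbc e1 e2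
    have := pi_conj_swap h.mult (swap a b) b c
    rw [swap_apply_right, swap_apply_of_ne_of_ne hac.symm hbc.symm, swap_inv] at this
    rw [← this, mul_assoc, e1, mul_smul_comm, mul_assoc, e2, mul_smul_comm, e1, smul_smul, smul_smul]
    congr 1
    linear_combination (-ε) * hεε
  have h25 := tri 2 3 5 (by decide) (by decide) h23 h35
  have h34 := tri 3 2 4 (by decide) (by decide) (by rw [swap_comm]; exact h23) h24
  by_contra hf
  have X0 := congrArg (· * f) (hx 0)
  have X1 := congrArg (· * f) (hx 1)
  have X2 := congrArg (· * f) (hx 2)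
  have X3 := congrArg (· * f) (hx 3)
  have X4 := congrArg (· * f) (hx 4)
  have X5 := congrArg (· * f) (hx 5)
  simp only [X, Fin.sum_univ_six, smul_mul_assoc, one_mul, add_mul, hself] at X0 X1 X2 X3 X4 X5
  rw [swap_comm 1 0] at X1
  rw [swap_comm 2 0, swap_comm 2 1] at X2
  rw [swap_comm 3 0, swap_comm 3 1, swap_comm 3 2] at X3
  rw [swap_comm 4 0, swap_comm 4 1, swap_comm 4 2, swap_comm 4 3] at X4
  rw [swap_comm 5 0, swap_comm 5 1, swap_comm 5 2, swap_comm 5 3, swap_comm 5 4] at X5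
  rw [h01] at X0 X1
  rw [h23, h24, h25] at X2
  rw [h23, h34, h35] at X3
  rw [h24, h34, h45] at X4
  rw [h25, h35, h45] at X5
  have hx0 : (2 * (x - (1 - 5 * ε))) • f = 0 := by
    linear_combination (norm := module) X0 + X1 - X2 - X3 - X4 - X5
  have hxv : x = 1 - 5 * ε := by
    have := (smul_eq_zero.1 hx0).resolve_right hf
    linear_combination this / 2
  have uv : ∀ k : Fin 6, k ≠ 0 → k ≠ 1 → π (swap 0 k) * f + π (swap 1 k) * f = (-2 * ε) • f →
      π (swap 0 k) * f = (-ε) • f ∧ π (swap 1 k) * f = (-ε) • f := by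
    intro k hk0 hk1 e1
    have e2 : f - ε • (π (swap 1 k) * f) = (-2 * ε) • (π (swap 0 k) * f) := by
      have := congrArg (fun M => π (swap 0 k) * M) e1
      simp only [mul_add, ← mul_assoc, hsq, one_mul, mul_smul_comm] at this
      have c1 := pi_conj_swap h.mult (swap 0 1) 0 k
      rw [swap_apply_left, swap_apply_of_ne_of_ne hk0 hk1, swap_inv] at c1
      rw [swap_comm 1 k, triple_swap h.mult hk0 hk1 (by decide)] at this
      rw [← this, ← c1, mul_assoc _ _ f, h01, mul_smul_comm]
      simp only [smul_smul]
      rw [mul_neg, hεε, neg_one_smul, sub_neg_eq_add]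
    rcases hε with rfl | rfl
    · have hu : π (swap 0 k) * f = (-1:ℂ) • f := by
        linear_combination (norm := module) (1/3:ℂ) • e1 + (1/3:ℂ) • e2
      refine ⟨hu, ?_⟩
      linear_combination (norm := module) e1 - hu
    · have hu : π (swap 0 k) * f = (-(-1):ℂ) • f := by
        linear_combination (norm := module) (1/3:ℂ) • e1 - (1/3:ℂ) • e2
      refine ⟨hu, ?_⟩
      linear_combination (norm := module) e1 - hu
  subst hxv
  obtain ⟨h02, h12⟩ := uv 2 (by decide) (by decide) (by linear_combination (norm := module) X2)
  obtain ⟨h03, h13⟩ := uv 3 (by decide) (by decide) (by linear_combination (norm := module) X3)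
  obtain ⟨h04, h14⟩ := uv 4 (by decide) (by decide) (by linear_combination (norm := module) X4)
  obtain ⟨h05, h15⟩ := uv 5 (by decide) (by decide) (by linear_combination (norm := module) X5)
  have hlt : ∀ a b : Fin 6, a < b → π (swap a b) * f = (-ε) • f := by
    intro a b hab
    fin_cases a <;> fin_cases b <;> first
      | exact h01 | exact h02 | exact h03 | exact h04 | exact h05 | exact h12 | exact h13 | exact h14 | exact h15
      | exact h23 | exact h24 | exact h25 | exact h34 | exact h35 | exact h45 | (exfalso; revert hab; decide)
  apply hf
  apply h.lin_swap (-ε)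
  intro a b hab
  rcases lt_or_gt_of_ne hab with h' | h'
  · exact hlt a b h'
  · rw [swap_comm]; exact hlt b a h'

theorem six [Nontrivial R] [FiniteDimensional ℂ R] {π : Perm (Fin 6) → R} (h : Irr π) (hNR : ¬ NR π) {ε : ℂ} (hε : ε * ε = 1)
    (x y : Fin 6) (hxy : x ≠ y) (hN : ¬ NR (pe π ε x y)) : coef π ^ 5 = ⊤ := by
  have H := six1 h x y hxy hε hN
  obtain ⟨z, hz⟩ := h.rect hNR
  have hε' : ε = 1 ∨ ε = -1 := by
    have : (ε - 1) * (ε + 1) = 0 := by linear_combination hε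
    rcases mul_eq_zero.1 this with q | q
    · left; linear_combination q
    · right; linear_combination q
  have Hn1 : ([0, 1, 2, 3, 4, 5] : List (Fin 6)).Nodup := by decide
  have Hn2 : ([0, 1, 2, 4, 3, 5] : List (Fin 6)).Nodup := by decide
  have hcom : YY π ε 0 1 2 3 4 5 * YY π ε 0 1 2 4 3 5 = YY π ε 0 1 2 4 3 5 * YY π ε 0 1 2 3 4 5 := by
    unfold YY
    rw [← h.mult, ← h.mult, ← h.mult, ← h.mult]
    have e : π (swap 0 1 * swap 2 3 * swap 4 5) * π (swap 0 1 * swap 2 4 * swap 3 5) =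
        π (swap 0 1 * swap 2 4 * swap 3 5) * π (swap 0 1 * swap 2 3 * swap 4 5) := by
      rw [← h.mult, ← h.mult]
      congr 1
      decide
    simp only [mul_sub, sub_mul, mul_one, one_mul, mul_smul_comm, smul_mul_assoc, e]
    module
  have hf : YY π ε 0 1 2 3 4 5 * YY π ε 0 1 2 4 3 5 = 0 := by
    apply six3 h hε' z hz
    · rw [← mul_assoc, six2 h hε H _ _ _ _ _ _ Hn1, smul_mul_assoc]
    · rw [← mul_assoc, YY_perm1 h _ _ _ _ _ _ _ Hn1, six2 h hε H _ _ _ _ _ _ (by decide), smul_mul_assoc]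
    · rw [← mul_assoc, YY_perm2 h _ _ _ _ _ _ _ Hn1, six2 h hε H _ _ _ _ _ _ (by decide), smul_mul_assoc]
    · rw [hcom, ← mul_assoc, YY_perm1 h _ _ _ _ _ _ _ Hn2, six2 h hε H _ _ _ _ _ _ (by decide), smul_mul_assoc]
    · rw [hcom, ← mul_assoc, YY_perm2 h _ _ _ _ _ _ _ Hn2, six2 h hε H _ _ _ _ _ _ (by decide), smul_mul_assoc]
  have h' : Irr (fun g => π (outEquiv g)) := by
    refine ⟨?_, ?_, ?_, ?_⟩
    · intro g g'
      beta_reduce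
      rw [map_mul, h.mult]
    · beta_reduce
      rw [map_one, h.one]
    · intro z hz
      apply h.schur
      intro g
      obtain ⟨g, rfl⟩ := outEquiv.surjective g
      exact hz g
    · intro f hf
      apply h.lin
      intro g
      obtain ⟨g, rfl⟩ := outEquiv.surjective g
      exact hf g
  have hNR' : NR (fun g => π (outEquiv g)) := by
    by_contra hcon
    apply R0 h' hcon (by simp) (ε := -ε) (by rw [neg_mul_neg, hε]) (a := 0) (b := 1) (c := 4) (d := 5) (by decide) (by decide)
      (by decide) (by decide) (by decide) (by decide)
    rw [← hf]
    unfold yy YY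
    beta_reduce
    rw [out0, out4, h.mult, h.mult, h.mult, h.mult]
    simp only [neg_smul, sub_eq_add_neg]
  apply top_of_equiv outEquiv ((LInv.coef h.mult).pow _)
  rw [Submodule.map_pow, map_pull_coef, pow_succ]
  have h2 := NR.NL2 h'.mult hNR'
  exact Pm 6 (Fin 6) (by simp) (by norm_num) _ _ h'.mult h'.mult (NL2.NL1 h'.mult (by simp) h2) h2 (fun _ => hNR')

theorem main_coef [Nontrivial R] [FiniteDimensional ℂ R] {n : ℕ} (hn : 4 < n) {π : Perm (Fin n) → R} (h : Irr π) :
    coef π ^ (n - 1) = ⊤ := by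
  by_cases hNR : NR π
  · have h2 := NR.NL2 h.mult hNR
    have := Pm n (Fin n) (by simp) (by omega) _ _ h.mult h.mult (NL2.NL1 h.mult (by simp; omega) h2) h2 (fun _ => hNR)
    rw [← pow_succ] at this
    rwa [show n - 2 + 1 = n - 1 by omega] at this
  · rcases R4 h hNR (by simp; omega) with H | ⟨h6, ε, hε, x, y, hxy, H⟩
    · rwa [Fintype.card_fin] at H
    · rw [Fintype.card_fin] at h6
      subst h6
      exact six h hNR hε x y hxy H


end

section

section
variable {G : Type} [Group G] [Fintype G]

lemma sum_coef_zero {T : Type} [AddCommGroup T] [Module ℂ T] [FiniteDimensional ℂ T]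
    (ρ : Representation ℂ G T) (h : ∑ g, ρ.character g = 0) (f : G → ℂ) (hf : f ∈ coef (fun g => ρ g)) :
    ∑ g, f g = 0 := by
  have inv1 : Invertible (Nat.card G : ℂ) := invertibleOfNonzero (by simp)
  have h1 := Representation.card_inv_mul_sum_char_eq_finrank ρ
  rw [h, mul_zero] at h1
  have h2 : Module.finrank ℂ ρ.invariants = 0 := by exact_mod_cast h1.symm
  have h3 : ρ.invariants = ⊥ := Submodule.finrank_eq_zero.1 h2
  have h4 : ∑ g, ρ g = 0 := by
    ext v
    have : (∑ g, ρ g) v ∈ ρ.invariants := by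
      rw [Representation.mem_invariants]
      intro g
      rw [LinearMap.sum_apply, map_sum]
      apply Fintype.sum_equiv (Equiv.mulLeft g)
      intro x
      simp
    rw [h3] at this
    simpa using this
  obtain ⟨l, hl⟩ := hf
  simp only [hl]
  rw [← map_sum, h4, map_zero]

lemma coef_tprod {T U : Type} [AddCommGroup T] [Module ℂ T] [FiniteDimensional ℂ T]
    [AddCommGroup U] [Module ℂ U] [FiniteDimensional ℂ U]
    (ρ : Representation ℂ G T) (σ : Representation ℂ G U) :
    coef (fun g => ρ g) * coef (fun g => σ g) ≤ coef (fun g => (ρ.tprod σ) g) := by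
  rw [Submodule.mul_le]
  rintro f ⟨l, hl⟩ f' ⟨l', hl'⟩
  refine ⟨(LinearMap.mul' ℂ ℂ ∘ₗ TensorProduct.map l l') ∘ₗ (homTensorHomEquiv ℂ T U T U).symm.toLinearMap, ?_⟩
  intro g
  have : (ρ.tprod σ) g = homTensorHomEquiv ℂ T U T U ((ρ g) ⊗ₜ[ℂ] (σ g)) := by
    rw [homTensorHomEquiv_apply]
    rfl
  simp only [LinearMap.comp_apply, LinearEquiv.coe_coe]
  rw [this, LinearEquiv.symm_apply_apply]
  simp [hl, hl']

lemma exists_pow {T : Type} [AddCommGroup T] [Module ℂ T] [FiniteDimensional ℂ T]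
    (ρ : Representation ℂ G T) (k : ℕ) :
    ∃ (U : Type) (_ : AddCommGroup U) (_ : Module ℂ U) (_ : FiniteDimensional ℂ U) (σ : Representation ℂ G U),
      σ.character = ρ.character ^ k ∧ coef (fun g => ρ g) ^ k ≤ coef (fun g => σ g) := by
  induction k with
  | zero =>
    refine ⟨ℂ, inferInstance, inferInstance, inferInstance, Representation.trivial ℂ G ℂ, ?_, ?_⟩
    · ext g
      simp [Representation.character]
    · rw [pow_zero, Submodule.one_le]
      refine ⟨LinearMap.trace ℂ ℂ, fun g => ?_⟩
      simp
  | succ k ih =>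
    obtain ⟨U, i1, i2, i3, σ, h1, h2⟩ := ih
    refine ⟨TensorProduct ℂ U T, inferInstance, inferInstance, inferInstance, σ.tprod ρ, ?_, ?_⟩
    · rw [Representation.char_tensor, h1, pow_succ]
    · rw [pow_succ]
      exact (mul_le_mul' h2 le_rfl).trans (coef_tprod σ ρ)

lemma exists_conj {T : Type} [AddCommGroup T] [Module ℂ T] [FiniteDimensional ℂ T]
    (ρ : Representation ℂ G T) :
    ∃ (U : Type) (_ : AddCommGroup U) (_ : Module ℂ U) (_ : FiniteDimensional ℂ U) (σ : Representation ℂ G U),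
      σ.character = fun g => (starRingEnd ℂ) (ρ.character g) := by
  let b := Module.finBasis ℂ T
  let m := Module.finrank ℂ T
  let F : G →* Matrix (Fin m) (Fin m) ℂ :=
    (RingHom.mapMatrix (starRingEnd ℂ)).toMonoidHom.comp
      ((LinearMap.toMatrixAlgEquiv b).toRingEquiv.toRingHom.toMonoidHom.comp ρ)
  refine ⟨Fin m → ℂ, inferInstance, inferInstance, inferInstance,
    (Matrix.toLinAlgEquiv' (R := ℂ) (n := Fin m)).toRingEquiv.toRingHom.toMonoidHom.comp F, ?_⟩
  ext g
  have e1 : ρ.character g = Matrix.trace (LinearMap.toMatrixAlgEquiv b (ρ g)) := by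
    rw [Representation.character, LinearMap.trace_eq_matrix_trace ℂ b]
    rfl
  have e2 : ∀ M : Matrix (Fin m) (Fin m) ℂ, LinearMap.trace ℂ _ (Matrix.toLinAlgEquiv' M) = Matrix.trace M := by
    intro M
    exact Matrix.trace_toLin'_eq M
  rw [e1, Representation.character]
  refine (e2 (F g)).trans ?_
  simp [F, Matrix.trace]
  rfl

lemma Irr.of_simple {α : Type} [Fintype α] [DecidableEq α] {T : Type} [AddCommGroup T] [Module ℂ T] [FiniteDimensional ℂ T]
    (ρ : Representation ℂ (Perm α) T) (h : ∑ g, ρ.character g * ρ.character g⁻¹ = Nat.card (Perm α))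
    (hd : 1 < Module.finrank ℂ T) : Irr (fun g => ρ g) := by
  have inv1 : Invertible (Nat.card (Perm α) : ℂ) := invertibleOfNonzero (by simp)
  have h1 := Representation.card_inv_mul_sum_char_mul_char_eq_finrank ρ ρ
  rw [h, inv_mul_cancel_of_invertible] at h1
  have h2 : Module.finrank ℂ (Representation.IntertwiningMap ρ ρ) = 1 := by exact_mod_cast h1.symm
  have hnt : Nontrivial T := Module.nontrivial_of_finrank_pos (R := ℂ) (by omega)
  have hs : ∀ z : Module.End ℂ T, (∀ g, z * ρ g = ρ g * z) → ∃ x : ℂ, z = x • (1 : Module.End ℂ T) := by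
    intro z hz
    let Z : Representation.IntertwiningMap ρ ρ := ⟨z, hz⟩
    let I : Representation.IntertwiningMap ρ ρ := ⟨LinearMap.id, fun g => by ext; rfl⟩
    have hI : I ≠ 0 := by
      intro h0
      obtain ⟨v, hv⟩ := exists_ne (0 : T)
      exact hv (congrArg (fun J : Representation.IntertwiningMap ρ ρ => J.toLinearMap v) h0)
    obtain ⟨c, hc⟩ := (finrank_eq_one_iff_of_nonzero' I hI).1 h2 Z
    refine ⟨c, ?_⟩
    exact (congrArg (fun J : Representation.IntertwiningMap ρ ρ => J.toLinearMap) hc).symm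
  refine ⟨fun g g' => map_mul ρ g g', map_one ρ, hs, ?_⟩
  intro f hf
  by_contra hf0
  choose c hc using hf
  obtain ⟨v, hv⟩ : ∃ v, f v ≠ 0 := by
    by_contra hcon
    push Not at hcon
    exact hf0 (LinearMap.ext hcon)
  obtain ⟨φ, hφ⟩ := Module.Projective.exists_dual_eq_one ℂ hv
  let A : Module.End ℂ T := LinearMap.smulRight φ v
  let z : Module.End ℂ T := ∑ g, ρ g * (f * A) * ρ g⁻¹
  have htr : LinearMap.trace ℂ T (f * A) = 1 := by
    have : f * A = LinearMap.smulRight φ (f v) := by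
      ext x
      simp [A]
    rw [this, LinearMap.trace_smulRight, hφ]
  obtain ⟨x, hx⟩ := hs z (by
    intro g
    simp only [z, Finset.sum_mul, Finset.mul_sum]
    apply Fintype.sum_equiv (Equiv.mulLeft g⁻¹)
    intro y
    simp only [Equiv.coe_mulLeft, map_mul, mul_inv_rev, inv_inv, ← mul_assoc]
    rw [← map_mul ρ g g⁻¹]
    simp)
  have hx0 : x ≠ 0 := by
    rintro rfl
    have t : LinearMap.trace ℂ T z = Fintype.card (Perm α) := by
      simp only [z, map_sum]
      rw [Finset.sum_congr rfl (g := fun _ => (1:ℂ))]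
      · simp
      · intro g _
        rw [LinearMap.trace_mul_comm, ← mul_assoc, ← map_mul, inv_mul_cancel, map_one, one_mul, htr]
    rw [hx, zero_smul, map_zero] at t
    exact Nat.cast_ne_zero.2 Fintype.card_ne_zero t.symm
  have hB : f * (∑ g, c g • (A * ρ g⁻¹)) = x • 1 := by
    rw [← hx]
    simp only [z, Finset.mul_sum]
    apply Finset.sum_congr rfl
    intro g _
    rw [← mul_assoc (ρ g), hc]
    simp [mul_assoc]
  have hsc : ∀ g, ρ g = c g • 1 := by
    intro g
    have := congrArg (fun M => M * (∑ g, c g • (A * ρ g⁻¹))) (hc g)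
    simp only [mul_assoc, smul_mul_assoc] at this
    rw [hB, mul_smul_comm, mul_one, smul_comm] at this
    exact smul_right_injective _ hx0 this
  have : Module.finrank ℂ T ≤ 1 := by
    apply finrank_le_one (f v)
    intro u
    obtain ⟨y, hy⟩ := hs (LinearMap.smulRight φ u) (by
      intro g
      rw [hsc]
      simp)
    refine ⟨y, ?_⟩
    have := congrArg (fun M : Module.End ℂ T => M (f v)) hy
    simp [hφ] at this
    exact this.symm
  omega

theorem forward {n : ℕ} (hn : 4 < n) {k : ℕ} (hk : n - 1 ≤ k) {T U : Type}
    [AddCommGroup T] [Module ℂ T] [FiniteDimensional ℂ T] [AddCommGroup U] [Module ℂ U] [FiniteDimensional ℂ U]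
    (ρ : Representation ℂ (Perm (Fin n)) T) (h : ∑ g, ρ.character g * ρ.character g⁻¹ = Nat.card (Perm (Fin n)))
    (hd : 1 < Module.finrank ℂ T) (σ : Representation ℂ (Perm (Fin n)) U) (hU : Module.finrank ℂ U ≠ 0) :
    ∑ g, (ρ.character ^ k) g * (starRingEnd ℂ) (σ.character g) ≠ 0 := by
  intro h0
  have hI := Irr.of_simple ρ h hd
  have hnt : Nontrivial T := Module.nontrivial_of_finrank_pos (R := ℂ) (by omega)
  have hm := main_coef hn hI
  obtain ⟨V, i1, i2, i3, τ, ht1, ht2⟩ := exists_pow ρ k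
  obtain ⟨W, j1, j2, j3, σ', hs⟩ := exists_conj σ
  have h1 : ∑ g, (τ.tprod σ').character g = 0 := by
    rw [Representation.char_tensor, ht1, hs]
    exact h0
  have hk' : coef (fun g => ρ g) ^ k = coef (fun g => ρ g) ^ (n - 1) * coef (fun g => ρ g) ^ (k - (n - 1)) := by
    rw [← pow_add]
    congr 1
    omega
  have hc : ∀ g, ρ.character g = LinearMap.trace ℂ T (ρ g) := fun g => rfl
  have hcρ : ρ.character ∈ coef (fun g => ρ g) := ⟨LinearMap.trace ℂ T, fun g => rfl⟩
  have hcσ : σ'.character ∈ coef (fun g => σ' g) := ⟨LinearMap.trace ℂ W, fun g => rfl⟩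
  have hF : (Pi.single (1 : Perm (Fin n)) (1 : ℂ) * ρ.character ^ (k - (n - 1))) * σ'.character ∈
      coef (fun g => (τ.tprod σ') g) := by
    apply coef_tprod
    apply Submodule.mul_mem_mul _ hcσ
    apply ht2
    rw [hk', hm]
    exact Submodule.mul_mem_mul trivial (Submodule.pow_mem_pow _ hcρ _)
  have h2 := sum_coef_zero _ h1 _ hF
  rw [Fintype.sum_eq_single 1] at h2
  · rw [hs] at h2
    simp at h2
    rcases h2 with h2 | h2
    · omega
    · exact hU h2
  · intro g hg
    simp [hg]

end

end

section

section
variable {n : ℕ}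

/-- number of fixed points -/
def fx (g : Perm (Fin n)) : ℂ := ∑ i, if g i = i then 1 else 0

/-- sign as complex number -/
def sg (g : Perm (Fin n)) : ℂ := ((Perm.sign g : ℤ) : ℂ)

lemma sg_mul (g h : Perm (Fin n)) : sg (g * h) = sg g * sg h := by simp [sg]

lemma sg_one : sg (1 : Perm (Fin n)) = 1 := by simp [sg]

lemma sg_sq (g : Perm (Fin n)) : sg g * sg g = 1 := by
  rw [sg]
  rcases Int.units_eq_one_or (Perm.sign g) with h | h <;> simp [h]

lemma sg_inv (g : Perm (Fin n)) : sg g⁻¹ = sg g := by simp [sg]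

lemma fx_inv (g : Perm (Fin n)) : fx g⁻¹ = fx g := by
  unfold fx
  apply Finset.sum_congr rfl
  intro i _
  congr 1
  rw [Perm.inv_eq_iff_eq]
  exact propext eq_comm

lemma fx_one : fx (1 : Perm (Fin n)) = n := by simp [fx]

/-- stabilizer sizes -/
def S1 (i a : Fin n) : ℂ := ∑ g : Perm (Fin n), if g i = a then 1 else 0

def S2 (i j a b : Fin n) : ℂ := ∑ g : Perm (Fin n), if g i = a ∧ g j = b then 1 else 0

lemma S1_eq (i a b : Fin n) : S1 i a = S1 i b := by
  apply Fintype.sum_equiv (Equiv.mulLeft (swap a b))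
  intro g
  congr 1
  simp [swap_apply_eq_iff]

lemma S1_sum (i : Fin n) : ∑ a, S1 i a = Fintype.card (Perm (Fin n)) := by
  unfold S1
  rw [Finset.sum_comm]
  simp

lemma S1_val (i : Fin n) : n * S1 i i = Fintype.card (Perm (Fin n)) := by
  rw [← S1_sum i, Finset.sum_congr rfl (fun a _ => S1_eq i a i)]
  simp

lemma S2_eq {i j a b b' : Fin n} (hb : a ≠ b) (hb' : a ≠ b') : S2 i j a b = S2 i j a b' := by
  apply Fintype.sum_equiv (Equiv.mulLeft (swap b b'))
  intro g
  congr 1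
  simp [swap_apply_eq_iff, swap_apply_of_ne_of_ne hb hb']

lemma S2_zero {i j a : Fin n} (hij : i ≠ j) : S2 i j a a = 0 := by
  apply Finset.sum_eq_zero
  intro g _
  rw [if_neg]
  rintro ⟨h1, h2⟩
  exact hij (g.injective (h1.trans h2.symm))

lemma S2_sum (i j a : Fin n) : ∑ b, S2 i j a b = S1 i a := by
  unfold S2 S1
  rw [Finset.sum_comm]
  apply Finset.sum_congr rfl
  intro g _
  by_cases h : g i = a <;> simp [h]

lemma S2_val {i j : Fin n} (hij : i ≠ j) : ((n : ℂ) - 1) * S2 i j i j = S1 i i := by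
  rw [← S2_sum i j i, ← Finset.add_sum_erase _ _ (Finset.mem_univ i), S2_zero hij, zero_add,
    Finset.sum_congr rfl (fun b hb => S2_eq (b' := j) (Finset.ne_of_mem_erase hb).symm hij)]
  rw [Finset.sum_const, Finset.card_erase_of_mem (Finset.mem_univ i), nsmul_eq_mul, Finset.card_univ, Fintype.card_fin,
    Nat.cast_sub (by have := i.2; omega), Nat.cast_one]

lemma sum_fx (hn : 0 < n) : ∑ g : Perm (Fin n), fx g = Fintype.card (Perm (Fin n)) := by
  unfold fx
  rw [Finset.sum_comm]
  have h : ∀ i : Fin n, (∑ g : Perm (Fin n), if g i = i then (1:ℂ) else 0) = (n:ℂ)⁻¹ * Fintype.card (Perm (Fin n)) := by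
    intro i
    rw [← S1_val i, ← mul_assoc, inv_mul_cancel₀ (by exact_mod_cast hn.ne'), one_mul]
    rfl
  rw [Finset.sum_congr rfl (fun i _ => h i)]
  simp
  rw [← mul_assoc, mul_inv_cancel₀ (by exact_mod_cast hn.ne'), one_mul]

lemma sum_fx_sq (hn : 1 < n) : ∑ g : Perm (Fin n), fx g * fx g = 2 * Fintype.card (Perm (Fin n)) := by
  have h0 : ∑ g : Perm (Fin n), fx g * fx g = ∑ i : Fin n, ∑ j : Fin n, S2 i j i j := by
    unfold S2
    rw [Finset.sum_congr rfl (fun i _ => Finset.sum_comm), Finset.sum_comm]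
    apply Finset.sum_congr rfl
    intro g _
    unfold fx
    rw [Finset.sum_mul_sum]
    apply Finset.sum_congr rfl
    intro i _
    apply Finset.sum_congr rfl
    intro j _
    by_cases h1 : g i = i <;> by_cases h2 : g j = j <;> simp [h1, h2]
  have hn0 : (n : ℂ) ≠ 0 := by exact_mod_cast (by omega : n ≠ 0)
  have hn1 : (n : ℂ) - 1 ≠ 0 := by
    rw [sub_ne_zero]
    exact_mod_cast (by omega : n ≠ 1)
  have h1 : ∀ i : Fin n, ∑ j : Fin n, S2 i j i j = 2 * S1 i i := by
    intro i
    rw [← Finset.add_sum_erase _ _ (Finset.mem_univ i)]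
    have e1 : S2 i i i i = S1 i i := by simp [S2, S1]
    have e2 : ∀ j ∈ Finset.univ.erase i, S2 i j i j = ((n:ℂ) - 1)⁻¹ * S1 i i := by
      intro j hj
      rw [← S2_val (Finset.ne_of_mem_erase hj).symm, ← mul_assoc, inv_mul_cancel₀ hn1, one_mul]
    rw [e1, Finset.sum_congr rfl e2]
    rw [Finset.sum_const, Finset.card_erase_of_mem (Finset.mem_univ i), nsmul_eq_mul, Finset.card_univ, Fintype.card_fin,
      Nat.cast_sub (by omega), Nat.cast_one, ← mul_assoc, mul_inv_cancel₀ hn1]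
    ring
  rw [h0, Finset.sum_congr rfl (fun i _ => h1 i)]
  have h2 : ∀ i : Fin n, 2 * S1 i i = 2 * ((n:ℂ)⁻¹ * Fintype.card (Perm (Fin n))) := by
    intro i
    rw [← S1_val i, ← mul_assoc (n:ℂ)⁻¹, inv_mul_cancel₀ hn0, one_mul]
  rw [Finset.sum_congr rfl (fun i _ => h2 i)]
  rw [Finset.sum_const, nsmul_eq_mul, Finset.card_univ, Fintype.card_fin]
  field_simp

lemma sum_sg_fx {j : ℕ} (hj : j + 2 ≤ n) : ∑ g : Perm (Fin n), fx g ^ j * sg g = 0 := by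
  have h0 : ∀ g : Perm (Fin n), fx g ^ j = ∑ t : Fin j → Fin n, if ∀ s, g (t s) = t s then 1 else 0 := by
    intro g
    unfold fx
    rw [Finset.sum_pow', Fintype.piFinset_univ]
    apply Finset.sum_congr rfl
    intro t _
    rw [Finset.prod_ite_zero]
    simp
  simp only [h0, Finset.sum_mul]
  rw [Finset.sum_comm]
  apply Finset.sum_eq_zero
  intro t _
  have hcard : 1 < (Finset.univ \ Finset.univ.image t : Finset (Fin n)).card := by
    have h1 := Finset.le_card_sdiff (Finset.univ.image t) (Finset.univ : Finset (Fin n))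
    have h2 : (Finset.univ.image t).card ≤ j := by
      simpa using Finset.card_image_le (s := (Finset.univ : Finset (Fin j))) (f := t)
    rw [Finset.card_univ, Fintype.card_fin] at h1
    omega
  obtain ⟨a, ha, b, hb, hab⟩ := Finset.one_lt_card.1 hcard
  simp at ha hb
  have h3 : ∑ g : Perm (Fin n), (if ∀ s, g (t s) = t s then (1:ℂ) else 0) * sg g =
      ∑ g : Perm (Fin n), -((if ∀ s, g (t s) = t s then (1:ℂ) else 0) * sg g) := by
    apply Fintype.sum_equiv (Equiv.mulRight (swap a b))
    intro g
    have e : ∀ s, swap a b (t s) = t s := fun s => swap_apply_of_ne_of_ne (ha s) (hb s)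
    have e2 : sg (swap a b) = -1 := by simp [sg, Perm.sign_swap hab]
    simp [sg_mul, e, e2]
  rw [Finset.sum_neg_distrib] at h3
  exact self_eq_neg.1 h3

lemma sum_sg_std {k : ℕ} (hk : k + 2 ≤ n) : ∑ g : Perm (Fin n), (fx g - 1) ^ k * sg g = 0 := by
  simp only [sub_eq_add_neg, add_pow, Finset.sum_mul]
  rw [Finset.sum_comm]
  apply Finset.sum_eq_zero
  intro j hj
  have hj' : j ≤ k := by
    have := Finset.mem_range.1 hj
    omega
  have := sum_sg_fx (n := n) (j := j) (by omega)
  calc _ = ∑ g : Perm (Fin n), (fx g ^ j * sg g) * ((-1) ^ (k - j) * (k.choose j : ℂ)) := by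
        apply Finset.sum_congr rfl
        intro g _
        ring
    _ = 0 := by rw [← Finset.sum_mul, this, zero_mul]

/-- sum zero vectors -/
def Z (n : ℕ) : Submodule ℂ (Fin n → ℂ) := LinearMap.ker (∑ i, LinearMap.proj i : (Fin n → ℂ) →ₗ[ℂ] ℂ)

lemma mem_Z (v : Fin n → ℂ) : v ∈ Z n ↔ ∑ i, v i = 0 := by
  rw [Z, LinearMap.mem_ker]
  simp [LinearMap.sum_apply]

def pact (g : Perm (Fin n)) : (Fin n → ℂ) →ₗ[ℂ] (Fin n → ℂ) := LinearMap.funLeft ℂ ℂ (g⁻¹ : Perm (Fin n))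

lemma pact_apply (g : Perm (Fin n)) (v : Fin n → ℂ) (i : Fin n) : pact g v i = v (g⁻¹ i) := rfl

lemma pact_sum (g : Perm (Fin n)) (v : Fin n → ℂ) : ∑ i, pact g v i = ∑ i, v i :=
  Equiv.sum_comp (g⁻¹ : Perm (Fin n)) v

lemma pact_mem (g : Perm (Fin n)) (v : Fin n → ℂ) (hv : v ∈ Z n) : pact g v ∈ Z n := by
  rw [mem_Z] at *
  rw [pact_sum, hv]

def stdRep (n : ℕ) : Representation ℂ (Perm (Fin n)) (Z n) where
  toFun g := (pact g).restrict (pact_mem g)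
  map_one' := by
    ext v i
    rfl
  map_mul' g h := by
    ext v i
    simp [pact_apply]

lemma pact_trace (g : Perm (Fin n)) : LinearMap.trace ℂ _ (pact g) = fx g := by
  rw [LinearMap.trace_eq_matrix_trace ℂ (Pi.basisFun ℂ (Fin n)), Matrix.trace, ← fx_inv]
  unfold fx
  apply Finset.sum_congr rfl
  intro i _
  simp [LinearMap.toMatrix_apply, pact_apply, Pi.single_apply]

lemma std_char (hn : 0 < n) (g : Perm (Fin n)) : (stdRep n).character g = fx g - 1 := by
  have hn0 : (n : ℂ) ≠ 0 := by exact_mod_cast hn.ne'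
  let A : (Fin n → ℂ) →ₗ[ℂ] (Fin n → ℂ) :=
    LinearMap.smulRight (∑ i, LinearMap.proj i : (Fin n → ℂ) →ₗ[ℂ] ℂ) (fun _ => (n:ℂ)⁻¹)
  have hA : ∀ v i, A v i = (∑ j, v j) * (n:ℂ)⁻¹ := by
    intro v i
    simp [A, LinearMap.sum_apply]
  have h1 : ∀ v, (pact g - A) v ∈ Z n := by
    intro v
    rw [mem_Z]
    simp only [LinearMap.sub_apply, Pi.sub_apply, hA, Finset.sum_sub_distrib, pact_sum]
    rw [Finset.sum_const, nsmul_eq_mul, Finset.card_univ, Fintype.card_fin]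
    field_simp
    ring
  have h2 := LinearMap.trace_restrict_eq_of_forall_mem (Z n) (pact g - A) h1
  have h3 : (pact g - A).restrict (p := Z n) (q := Z n) (fun x _ => h1 x) = stdRep n g := by
    ext v i
    have := (mem_Z _).1 v.2
    simp [stdRep, hA, this]
  rw [Representation.character, ← h3, h2, map_sub, pact_trace]
  congr 1
  rw [LinearMap.trace_smulRight]
  simp [LinearMap.sum_apply, hn0]

lemma std_norm (hn : 1 < n) : ∑ g, (stdRep n).character g * (stdRep n).character g⁻¹ = Nat.card (Perm (Fin n)) := by
  simp only [std_char (by omega : 0 < n), fx_inv]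
  have : ∀ g : Perm (Fin n), (fx g - 1) * (fx g - 1) = fx g * fx g - 2 * fx g + 1 := fun g => by ring
  simp only [this, Finset.sum_add_distrib, Finset.sum_sub_distrib, ← Finset.mul_sum, sum_fx (by omega : 0 < n), sum_fx_sq hn]
  simp [Nat.card_eq_fintype_card]

def sgRep (n : ℕ) : Representation ℂ (Perm (Fin n)) ℂ where
  toFun g := sg g • 1
  map_one' := by rw [sg_one, one_smul]
  map_mul' g h := by rw [sg_mul, smul_mul_smul_comm, one_mul]

lemma sg_char (g : Perm (Fin n)) : (sgRep n).character g = sg g := by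
  simp [Representation.character, sgRep]

lemma sg_norm : ∑ g, (sgRep n).character g * (sgRep n).character g⁻¹ = Nat.card (Perm (Fin n)) := by
  simp [sg_char, sg_inv, sg_sq, Nat.card_eq_fintype_card]

end

end

end SnCov

/-- For `n > 4` and `k ≥ 1`: `k ≥ n - 1` iff every irreducible character of `S_n` is a
constituent of `χ^k` for every irreducible character `χ` of `S_n` with `χ(1) > 1`. -/
theorem symmetricGroup_covering_number_e (n : ℕ) (hn : 4 < n) (k : ℕ) (hk : 0 < k) :
    n - 1 ≤ k ↔
      ∀ χ : Equiv.Perm (Fin n) → ℂ, IsIrredChar (Equiv.Perm (Fin n)) χ → 1 < χ 1 →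
        ∀ θ : Equiv.Perm (Fin n) → ℂ, IsIrredChar (Equiv.Perm (Fin n)) θ →
          charInner (Equiv.Perm (Fin n)) (χ ^ k) θ ≠ 0 := by
  constructor
  · rintro hkn χ ⟨V, hV, rfl⟩ hχ θ ⟨W, hW, rfl⟩
    rw [charInner]
    refine mul_ne_zero (inv_ne_zero (Nat.cast_ne_zero.2 Fintype.card_ne_zero)) ?_
    have h1 := (FDRep.simple_iff_char_is_norm_one V).1 hV
    have h2 := (FDRep.simple_iff_char_is_norm_one W).1 hW
    refine SnCov.forward (T := V) (U := W) hn hkn V.ρ h1 ?_ W.ρ ?_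
    · rw [FDRep.char_one] at hχ
      exact_mod_cast hχ
    · intro h0
      have hs : Subsingleton W := Module.finrank_zero_iff.1 h0
      have h3 : ∀ g, W.character g = 0 := by
        intro g
        have : W.ρ g = 0 := by
          ext v
          exact Subsingleton.elim _ _
        rw [FDRep.character, this, map_zero]
      simp only [h3, mul_zero, Finset.sum_const_zero] at h2
      exact Nat.cast_ne_zero.2 Nat.card_pos.ne' h2.symm
  · intro H
    by_contra hcon
    have hA : IsIrredChar (Equiv.Perm (Fin n)) (SnCov.stdRep n).character :=
      ⟨FDRep.of (SnCov.stdRep n), (FDRep.simple_iff_char_is_norm_one _).2 (SnCov.std_norm (by omega)), rfl⟩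
    have hB : IsIrredChar (Equiv.Perm (Fin n)) (SnCov.sgRep n).character :=
      ⟨FDRep.of (SnCov.sgRep n), (FDRep.simple_iff_char_is_norm_one _).2 SnCov.sg_norm, rfl⟩
    refine H _ hA ?_ _ hB ?_
    · rw [SnCov.std_char (by omega), SnCov.fx_one]
      have : (1 : ℂ) < ((n - 1 : ℕ) : ℂ) := by exact_mod_cast (by omega : 1 < n - 1)
      rwa [Nat.cast_sub (by omega), Nat.cast_one] at this
    · rw [charInner]
      have := SnCov.sum_sg_std (n := n) (k := k) (by omega)
      simp only [Pi.pow_apply, SnCov.std_char (by omega : 0 < n), SnCov.sg_char]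
      have e : ∀ g : Equiv.Perm (Fin n), (starRingEnd ℂ) (SnCov.sg g) = SnCov.sg g := by
        intro g
        simp [SnCov.sg]
      simp only [e, this, mul_zero]
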